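/- Let k be a field of characteristic zero, let A = k[x₁,…,xₙ]/(x₁^{d₁},…,xₙ^{dₙ}) be a monomial complete intersection with n ≥ 1 and all d_j ≥ 1, let ℓ = x₁ + ⋯ + xₙ, and let e = Σ_{j=1}^{n} (d_j − 1) be the socle degree of A. For 0 ≤ i ≤ e/2, let a_{n,i,(d₁,…,dₙ)} denote the absolute value of the determinant of the (square, integer) matrix of ·ℓ^{e−2i} : A_i → A_{e−i} with respect to the monomial bases. Then for n ≥ 2 and any 0 ≤ i ≤ e/2, setting t = e − 2i, B = k[x₁,…,x_{n−1}]/(x₁^{d₁},…,x_{n−1}^{d_{n−1}}) and h_j = dim_k B_j, one has a_{n,i,(d₁,…,dₙ)} = (∏_{j=max{0, dₙ−t}}^{min{i, dₙ−1}} a_{n−1,i−j,(d₁,…,d_{n−1})}) · ∏_{s=max{1, dₙ−i−1}}^{min{t−1, dₙ−1}} |det C_{t,s,dₙ}|^{h_{i+s−(dₙ−1)} − h_{i+s−dₙ}} (an equality of rational numbers, with empty products equal to 1 and a_{1,i,(d₁)} = 1). In particular a_{n,i,(d₁,…,dₙ)} ≠ 0 for all 0 ≤ i ≤ e/2, and A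 has the strong Lefschetz property. -/

import Mathlib

/-- Multiplication by `a` is injective as a map on the subspace `V`. -/
def MulInjOn {k R : Type*} [Field k] [CommRing R] [Algebra k R]
    (V : Submodule k R) (a : R) : Prop :=
  ∀ v ∈ V, a * v = 0 → v = 0

/-- Multiplication by `a` maps the subspace `V` onto the subspace `W`. -/
def MulSurjOnto {k R : Type*} [Field k] [CommRing R] [Algebra k R]
    (V W : Submodule k R) (a : R) : Prop :=
  ∀ w ∈ W, ∃ v ∈ V, a * v = w

/-- The multiplication map `·a : V → W` has full rank: it is injective or surjective. -/
def MulFullRank {k R : Type*} [Field k] [CommRing R] [Algebra k R]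
    (V W : Submodule k R) (a : R) : Prop :=
  MulInjOn V a ∨ MulSurjOnto V W a

/-- The strong Lefschetz property (for an `ℕ`-graded algebra). -/
def HasSLPN {k R : Type*} [Field k] [CommRing R] [Algebra k R]
    (𝒜 : ℕ → Submodule k R) : Prop :=
  ∃ ℓ ∈ 𝒜 1, ∀ i t : ℕ, 1 ≤ t → MulFullRank (𝒜 i) (𝒜 (i + t)) (ℓ ^ t)

/-- `binomZ t j` is the binomial coefficient `t` choose `j` for an integer `j`,
equal to `0` for `j < 0` or `j > t`. -/
def binomZ (t : ℕ) (j : ℤ) : ℤ := if 0 ≤ j then (t.choose j.toNat : ℤ) else 0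

/-- The `(d-p) × (d-p)` integer matrix `C_{t,p,d}` with entries `binom(t, d+1-r-c)`. -/
def Cmat (t p d : ℕ) : Matrix (Fin (d - p)) (Fin (d - p)) ℤ :=
  Matrix.of fun r c => binomZ t ((d : ℤ) - 1 - (r : ℕ) - (c : ℕ))

/-- The ideal `(x₁^{d₁}, …, xₙ^{dₙ})` of the polynomial ring. -/
noncomputable def ciIdeal (k : Type) [Field k] (n : ℕ) (dv : Fin n → ℕ) :
    Ideal (MvPolynomial (Fin n) k) :=
  Ideal.span { f : MvPolynomial (Fin n) k | ∃ j : Fin n, f = MvPolynomial.X j ^ dv j }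

/-- The degree-`i` component of `A = k[x₁,…,xₙ]/(x₁^{d₁},…,xₙ^{dₙ})`. -/
noncomputable def ciComp (k : Type) [Field k] (n : ℕ) (dv : Fin n → ℕ) (i : ℕ) :
    Submodule k (MvPolynomial (Fin n) k ⧸ ciIdeal k n dv) :=
  Submodule.map (Ideal.Quotient.mkₐ k (ciIdeal k n dv)).toLinearMap
    (MvPolynomial.homogeneousSubmodule (Fin n) k i)

/-- The linear form `ℓ = x₁ + ⋯ + xₙ` in `k[x₁,…,xₙ]/(x₁^{d₁},…,xₙ^{dₙ})`. -/
noncomputable def ciSumVars (k : Type) [Field k] (n : ℕ) (dv : Fin n → ℕ) :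
    MvPolynomial (Fin n) k ⧸ ciIdeal k n dv :=
  Ideal.Quotient.mkₐ k (ciIdeal k n dv) (∑ j : Fin n, MvPolynomial.X j)

/-- The exponent vectors of the monomial basis of the degree-`i` part of
`k[x₁,…,xₙ]/(x₁^{d₁},…,xₙ^{dₙ})`: tuples `a` with `a_j < d_j` and `∑ a_j = i`. -/
def monIdx {n : ℕ} (dv : Fin n → ℕ) (i : ℕ) : Type :=
  {a : (j : Fin n) → Fin (dv j) // ∑ j : Fin n, ((a j : ℕ)) = i}

noncomputable instance {n : ℕ} (dv : Fin n → ℕ) (i : ℕ) : Fintype (monIdx dv i) := by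
  unfold monIdx; infer_instance

instance {n : ℕ} (dv : Fin n → ℕ) (i : ℕ) : DecidableEq (monIdx dv i) := by
  unfold monIdx; infer_instance

/-- The complementation bijection `a ↦ (d₁-1-a₁, …, dₙ-1-aₙ)` between the monomial bases
in complementary degrees `i` and `e - i`, where `e = ∑ (d_j - 1)` is the socle degree. -/
noncomputable def monCompl {n : ℕ} (dv : Fin n → ℕ) (i : ℕ)
    (hi : i ≤ ∑ j : Fin n, (dv j - 1)) :
    monIdx dv i ≃ monIdx dv ((∑ j : Fin n, (dv j - 1)) - i) where
  toFun a := ⟨fun j => ⟨dv j - 1 - (a.1 j : ℕ), by have := (a.1 j).isLt; omega⟩, by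
    have h : ∀ j ∈ Finset.univ, ((a.1 j : ℕ)) ≤ dv j - 1 := fun j _ => by
      have := (a.1 j).isLt; omega
    simp [Finset.sum_tsub_distrib _ h, a.2]⟩
  invFun b := ⟨fun j => ⟨dv j - 1 - (b.1 j : ℕ), by have := (b.1 j).isLt; omega⟩, by
    have h : ∀ j ∈ Finset.univ, ((b.1 j : ℕ)) ≤ dv j - 1 := fun j _ => by
      have := (b.1 j).isLt; omega
    have hb := b.2
    have ha : ∀ j : Fin n, ((b.1 j : ℕ)) ≤ dv j - 1 := fun j => h j (Finset.mem_univ j)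
    have hle : (∑ j : Fin n, ((b.1 j : ℕ))) ≤ ∑ j : Fin n, (dv j - 1) :=
      Finset.sum_le_sum h
    simp only
    rw [Finset.sum_tsub_distrib _ h, hb]
    omega⟩
  left_inv a := by
    apply Subtype.ext; funext j
    apply Fin.ext
    have := (a.1 j).isLt
    simp only
    omega
  right_inv b := by
    apply Subtype.ext; funext j
    apply Fin.ext
    have := (b.1 j).isLt
    simp only
    omega

/-- The integer matrix of `·ℓ^{e-2i} : A_i → A_{e-i}` for
`A = k[x₁,…,xₙ]/(x₁^{d₁},…,xₙ^{dₙ})` and `ℓ = x₁ + ⋯ + xₙ` with respect to the monomial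
bases: the entry at row `x^b` and column `x^a` is the multinomial coefficient
`(e-2i)! / ∏ (b_j - a_j)!` if `a ≤ b` componentwise, and `0` otherwise. -/
noncomputable def ciMatrix {n : ℕ} (dv : Fin n → ℕ) (i : ℕ) :
    Matrix (monIdx dv ((∑ j : Fin n, (dv j - 1)) - i)) (monIdx dv i) ℤ :=
  Matrix.of fun b a =>
    if ∀ j : Fin n, (a.1 j : ℕ) ≤ (b.1 j : ℕ) then
      (Nat.multinomial Finset.univ (fun j : Fin n => (b.1 j : ℕ) - (a.1 j : ℕ)) : ℤ)
    else 0

/-- `a_{n,i,(d₁,…,dₙ)}`: the absolute value of the determinant of the matrix of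
`·ℓ^{e-2i} : A_i → A_{e-i}` in the monomial bases. -/
noncomputable def ciDetAbs {n : ℕ} (dv : Fin n → ℕ) (i : ℕ) : ℚ :=
  if hi : i ≤ ∑ j : Fin n, (dv j - 1) then
    |(((ciMatrix dv i).submatrix (monCompl dv i hi) id).det : ℚ)|
  else 1

/-- The Hilbert function `h_j = dim_k k[x₁,…,xₙ]/(x₁^{d₁},…,xₙ^{dₙ})_j`, i.e. the number
of monomials `x^a` with `a_j < d_j` and `∑ a_j = j` (zero in negative degrees). -/
noncomputable def ciHilb {n : ℕ} (dv : Fin n → ℕ) (j : ℤ) : ℕ :=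
  if 0 ≤ j then Fintype.card (monIdx dv j.toNat) else 0

/-- The absolute value of the determinant of a matrix whose rows and columns are indexed by
types of equal cardinality (and `0` if the cardinalities differ). -/
noncomputable def absDet {α β : Type*} [Fintype β] [DecidableEq β] (M : Matrix α β ℚ) : ℚ :=
  open Classical in
  if h : Nonempty (β ≃ α) then |(M.submatrix h.some id).det| else 0

section AbsDet

variable {α β γ α' β' ο : Type*} [Fintype β] [DecidableEq β]
  [Fintype γ] [DecidableEq γ] [Fintype β'] [DecidableEq β']

theorem absDet_eq (M : Matrix α β ℚ) (e : β ≃ α) : absDet M = |(M.submatrix e id).det| := by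
  have h : Nonempty (β ≃ α) := ⟨e⟩
  rw [absDet, dif_pos h]
  have : M.submatrix h.some id
      = (M.submatrix e id).submatrix (h.some.trans e.symm) id := by
    ext x y; simp
  rw [this, Matrix.det_permute]
  rcases Int.units_eq_one_or (Equiv.Perm.sign (h.some.trans e.symm)) with h | h <;> simp [h]

theorem absDet_submatrix (M : Matrix α β ℚ) (e₁ : α' ≃ α) (e₂ : β' ≃ β) :
    absDet (M.submatrix e₁ e₂) = absDet M := by
  by_cases h : Nonempty (β ≃ α)
  · obtain ⟨e⟩ := h
    rw [absDet_eq M e, absDet_eq _ ((e₂.trans e).trans e₁.symm),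
      ← Matrix.det_submatrix_equiv_self e₂]
    congr 2
    ext x y; simp
  · have h' : ¬ Nonempty (β' ≃ α') := fun ⟨e⟩ => h ⟨(e₂.symm.trans e).trans e₁⟩
    simp [absDet, h, h']

theorem nonempty_equiv_of_absDet_ne_zero {M : Matrix α β ℚ} (h : absDet M ≠ 0) :
    Nonempty (β ≃ α) := by
  by_contra h'
  simp [absDet, h'] at h

theorem absDet_mul (M : Matrix α β ℚ) (N : Matrix β γ ℚ) (e₁ : β ≃ α) (e₂ : γ ≃ β) :
    absDet (M * N) = absDet M * absDet N := by
  rw [absDet_eq M e₁, absDet_eq N e₂, absDet_eq (M * N) (e₂.trans e₁), ← abs_mul,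
    ← Matrix.det_submatrix_equiv_self e₂ (M.submatrix e₁ id), ← Matrix.det_mul]
  congr 2
  ext x y
  simp [Matrix.mul_apply]
  exact (Equiv.sum_comp e₂ (fun j => M (e₁ (e₂ x)) j * N j y)).symm

theorem absDet_square (M : Matrix β β ℚ) : absDet M = |M.det| := by
  rw [absDet_eq M (Equiv.refl β)]; simp

theorem absDet_nonneg (M : Matrix α β ℚ) : 0 ≤ absDet M := by
  unfold absDet; split_ifs <;> simp

theorem absDet_of_isEmpty [IsEmpty α] [IsEmpty β] (M : Matrix α β ℚ) : absDet M = 1 := by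
  rw [absDet_eq M (Equiv.equivOfIsEmpty β α)]; simp

theorem absDet_ne_zero_of_injective (M : Matrix α β ℚ) (e : β ≃ α)
    (h : ∀ v : β → ℚ, M.mulVec v = 0 → v = 0) : absDet M ≠ 0 := by
  rw [absDet_eq M e]
  intro h0
  rw [abs_eq_zero] at h0
  obtain ⟨v, hv, hv0⟩ := Matrix.exists_mulVec_eq_zero_iff.mpr h0
  apply hv
  apply h
  ext x
  have := congrFun hv0 (e.symm x)
  simpa [Matrix.mulVec, dotProduct] using this

theorem mulVec_injective_of_absDet_ne_zero {M : Matrix α β ℚ} (h : absDet M ≠ 0)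
    (v : β → ℚ) (hv : M.mulVec v = 0) : v = 0 := by
  obtain ⟨e⟩ := nonempty_equiv_of_absDet_ne_zero h
  rw [absDet_eq M e] at h
  by_contra hv0
  apply h
  rw [abs_eq_zero]
  refine Matrix.exists_mulVec_eq_zero_iff.mp ⟨v, hv0, ?_⟩
  ext x
  simpa [Matrix.mulVec, dotProduct] using congrFun hv (e x)

theorem mulVec_surjective_of_absDet_ne_zero [Fintype α] {M : Matrix α β ℚ} (h : absDet M ≠ 0) :
    Function.Surjective M.mulVec := by
  obtain ⟨e⟩ := nonempty_equiv_of_absDet_ne_zero h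
  have hinj : Function.Injective M.mulVecLin := by
    rw [← LinearMap.ker_eq_bot, LinearMap.ker_eq_bot']
    exact mulVec_injective_of_absDet_ne_zero h
  have := (LinearMap.injective_iff_surjective_of_finrank_eq_finrank
    (by simpa using Fintype.card_congr e)).mp hinj
  exact this

/-- The absolute determinant of a matrix which is block diagonal with respect to labellings
of its rows and columns. -/
theorem absDet_fiberwise [Fintype ο] [DecidableEq ο] (M : Matrix α β ℚ) (f : α → ο) (g : β → ο)
    (hM : ∀ a b, f a ≠ g b → M a b = 0)
    (he : ∀ o, Nonempty ({b // g b = o} ≃ {a // f a = o})) :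
    absDet M = ∏ o, absDet (M.submatrix (Subtype.val : {a // f a = o} → α)
      (Subtype.val : {b // g b = o} → β)) := by
  have e := fun o => (he o).some
  let E : β ≃ α := (Equiv.sigmaFiberEquiv g).symm.trans
    ((Equiv.sigmaCongrRight e).trans (Equiv.sigmaFiberEquiv f))
  have hE : ∀ (o : ο) (x : {b // g b = o}), E x = e o x := by
    rintro _ ⟨x, rfl⟩
    rfl
  let _ : LinearOrder ο := LinearOrder.lift' (Fintype.equivFin ο) (Fintype.equivFin ο).injective
  have htri : (M.submatrix E id).BlockTriangular g := by
    intro a b hab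
    apply hM
    have h1 : f (E a) = g a := by rw [hE (g a) ⟨a, rfl⟩]; exact (e (g a) ⟨a, rfl⟩).2
    rw [h1]
    exact (ne_of_lt hab).symm
  rw [absDet_eq M E, htri.det_fintype, Finset.abs_prod]
  refine Finset.prod_congr rfl fun o _ => ?_
  rw [absDet_eq _ (e o)]
  congr 2
  ext x y
  simp [Matrix.toSquareBlock, Matrix.toSquareBlockProp, hE]

end AbsDet

/-- Multiplication by `z` on `k[z]/(z^d)` in the monomial basis. -/
def shiftMatrix (R : Type*) [CommRing R] (d : ℕ) : Matrix (Fin d) (Fin d) R :=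
  Matrix.of fun j' j => if (j' : ℕ) = j + 1 then 1 else 0

theorem shiftMatrix_pow_apply {R : Type*} [CommRing R] (d m : ℕ) (j' j : Fin d) :
    (shiftMatrix R d ^ m) j' j = if (j' : ℕ) = j + m then 1 else 0 := by
  induction m generalizing j' with
  | zero => simp [Matrix.one_apply, Fin.ext_iff]
  | succ m ih =>
    rw [pow_succ', Matrix.mul_apply]
    simp_rw [ih, shiftMatrix, Matrix.of_apply]
    by_cases h : (j' : ℕ) = j + (m + 1)
    · rw [if_pos h, Finset.sum_eq_single (⟨j + m, by omega⟩ : Fin d)]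
      · simp; omega
      · intro b _ hb
        have : (b : ℕ) ≠ j + m := fun h' => hb (Fin.ext h')
        simp [this]
      · simp
    · rw [if_neg h]
      refine Finset.sum_eq_zero fun b _ => ?_
      split_ifs <;> first | omega | simp

/-- The matrix acting on a disjoint union of strings, the string labelled `s` having
length `L s`, by sending each element of a string to the next one. -/
def stringMatrix (R : Type*) [CommRing R] {S : Type*} [DecidableEq S] (L : S → ℕ) :
    Matrix (Σ s, Fin (L s)) (Σ s, Fin (L s)) R :=
  Matrix.of fun u' u => if u'.1 = u.1 ∧ (u'.2 : ℕ) = u.2 + 1 then 1 else 0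

theorem stringMatrix_pow_apply {R : Type*} [CommRing R] {S : Type*} [DecidableEq S] [Fintype S]
    (L : S → ℕ) (m : ℕ) (u' u : Σ s, Fin (L s)) :
    (stringMatrix R L ^ m) u' u = if u'.1 = u.1 ∧ (u'.2 : ℕ) = u.2 + m then 1 else 0 := by
  induction m generalizing u' with
  | zero =>
    obtain ⟨s', c'⟩ := u'
    obtain ⟨s, c⟩ := u
    by_cases h : s' = s
    · subst h; simp [Matrix.one_apply, Fin.ext_iff]
    · simp [h]
  | succ m ih =>
    rw [pow_succ', Matrix.mul_apply]
    simp_rw [ih, stringMatrix, Matrix.of_apply]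
    obtain ⟨s', c'⟩ := u'
    obtain ⟨s, c⟩ := u
    by_cases h : s' = s ∧ (c' : ℕ) = c + (m + 1)
    · obtain ⟨rfl, h⟩ := h
      rw [if_pos ⟨rfl, h⟩, Finset.sum_eq_single (⟨s', ⟨c + m, by omega⟩⟩ : Σ s, Fin (L s))]
      · simp; omega
      · rintro ⟨r, b⟩ _ hb
        by_cases hr : r = s'
        · subst hr
          have : (b : ℕ) ≠ c + m := fun h' => hb (by simp [Fin.ext_iff, h'])
          simp [this]
        · simp [hr]
      · simp
    · rw [if_neg h]
      refine Finset.sum_eq_zero fun b _ => ?_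
      dsimp only at *
      by_cases h1 : b.1 = s ∧ (b.2 : ℕ) = c + m
      · rw [if_neg, zero_mul]
        rintro ⟨h2, h3⟩
        exact h ⟨h2.trans h1.1, by omega⟩
      · simp [h1]

open scoped Kronecker in
/-- Multiplication by `ℓ + z` on `B[z]/(z^d)`, where `A` is the matrix of multiplication
by `ℓ` on `B`. -/
def tensorShift {R Y : Type*} [CommRing R] [DecidableEq Y] (A : Matrix Y Y R) (d : ℕ) :
    Matrix (Y × Fin d) (Y × Fin d) R :=
  A ⊗ₖ (1 : Matrix (Fin d) (Fin d) R) + (1 : Matrix Y Y R) ⊗ₖ shiftMatrix R d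

open scoped Kronecker in
theorem tensorShift_pow_apply {R Y : Type*} [CommRing R] [DecidableEq Y] [Fintype Y]
    (A : Matrix Y Y R) (d t : ℕ) (u' u : Y × Fin d) :
    (tensorShift A d ^ t) u' u = if (u.2 : ℕ) ≤ u'.2 ∧ (u'.2 : ℕ) ≤ u.2 + t then
      (t.choose (u'.2 - u.2) : R) * (A ^ (u.2 + t - u'.2)) u'.1 u.1 else 0 := by
  have hcomm : Commute (A ⊗ₖ (1 : Matrix (Fin d) (Fin d) R))
      ((1 : Matrix Y Y R) ⊗ₖ shiftMatrix R d) := by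
    unfold Commute SemiconjBy
    rw [← Matrix.mul_kronecker_mul, ← Matrix.mul_kronecker_mul]
    simp
  have h1 : ∀ m, (A ⊗ₖ (1 : Matrix (Fin d) (Fin d) R)) ^ m = (A ^ m) ⊗ₖ 1 := by
    intro m
    induction m with
    | zero => simp
    | succ m ih => rw [pow_succ, ih, ← Matrix.mul_kronecker_mul, pow_succ, one_mul]
  have h2 : ∀ m, ((1 : Matrix Y Y R) ⊗ₖ shiftMatrix R d) ^ m = 1 ⊗ₖ (shiftMatrix R d ^ m) := by
    intro m
    induction m with
    | zero => simp
    | succ m ih => rw [pow_succ, ih, ← Matrix.mul_kronecker_mul, pow_succ, one_mul]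
  have key : ∀ m, ((A ⊗ₖ (1 : Matrix (Fin d) (Fin d) R)) ^ m *
      ((1 : Matrix Y Y R) ⊗ₖ shiftMatrix R d) ^ (t - m) * ((t.choose m : ℕ) :
        Matrix (Y × Fin d) (Y × Fin d) R)) u' u =
      if (u'.2 : ℕ) = u.2 + (t - m) then (t.choose m : R) * (A ^ m) u'.1 u.1 else 0 := by
    intro m
    rw [h1, h2, ← Matrix.mul_kronecker_mul, mul_one, one_mul, ← nsmul_eq_mul', Matrix.smul_apply,
      Matrix.kroneckerMap_apply, shiftMatrix_pow_apply]
    split_ifs <;> simp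
  rw [tensorShift, hcomm.add_pow, Matrix.sum_apply, Finset.sum_congr rfl fun m _ => key m]
  split_ifs with h
  · rw [Finset.sum_eq_single (u.2 + t - u'.2 : ℕ)]
    · rw [if_pos (by omega), ← Nat.choose_symm (by omega)]
      congr 3; omega
    · intro b hb hb'
      rw [if_neg]
      simp at hb; omega
    · intro hb; simp at hb; omega
  · refine Finset.sum_eq_zero fun m hm => ?_
    rw [if_neg]
    simp at hm; omega

/-- The matrix of `·(y+z)^t` on `k[y,z]/(y^L,z^d)`, generated in degree `p`, from degree `i`
to degree `i + t`. -/
def stringBlock (L d p i t : ℕ) :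
    Matrix {v : Fin L × Fin d // p + v.1 + v.2 = i + t}
      {v : Fin L × Fin d // p + v.1 + v.2 = i} ℚ :=
  Matrix.of fun v' v => if (v.1.2 : ℕ) ≤ v'.1.2 then (t.choose (v'.1.2 - v.1.2) : ℚ) else 0

/-- Monomials of `k[y,z]/(y^L,z^d)` of a given degree are determined by their exponent of `z`. -/
def stringIdxEquiv {L d p i : ℕ} (h₁ : i < p + L) (h₂ : p + d ≤ i + 1) :
    Fin d ≃ {v : Fin L × Fin d // p + v.1 + v.2 = i} where
  toFun j := ⟨(⟨i - p - j, by omega⟩, j), by simp only; omega⟩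
  invFun v := v.1.2
  left_inv j := rfl
  right_inv v := by
    obtain ⟨⟨c, j⟩, h⟩ := v
    simp only at h
    simp only [Subtype.mk.injEq, Prod.mk.injEq, and_true, Fin.ext_iff]
    omega

theorem absDet_stringBlock_of_lt {L d p i t : ℕ} (h : L + 2 * p + d = 2 * i + t + 2)
    (hi : i < p) : absDet (stringBlock L d p i t) = 1 := by
  have : IsEmpty {v : Fin L × Fin d // p + v.1 + v.2 = i + t} :=
    ⟨fun v => by have := v.2; have := v.1.1.2; have := v.1.2.2; omega⟩
  have : IsEmpty {v : Fin L × Fin d // p + v.1 + v.2 = i} :=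
    ⟨fun v => by have := v.2; omega⟩
  exact absDet_of_isEmpty _

theorem absDet_stringBlock_of_le_left {L d p i t : ℕ} (h : L + 2 * p + d = 2 * i + t + 2)
    (hd : p + d ≤ i + 1) : absDet (stringBlock L d p i t) = 1 := by
  rw [← absDet_submatrix _ (stringIdxEquiv (by omega) (by omega))
    (stringIdxEquiv (by omega) (by omega)), absDet_square,
    Matrix.det_of_isLowerTriangular]
  · simp [stringBlock, stringIdxEquiv]
  · intro a b hab
    have hab : (a : ℕ) < b := hab
    simp only [stringBlock, stringIdxEquiv, Matrix.submatrix_apply, Matrix.of_apply,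
      Equiv.coe_fn_mk, if_neg (not_le.mpr hab)]

theorem stringBlock_swap {L d p i t : ℕ} :
    absDet (stringBlock d L p i t) = absDet (stringBlock L d p i t) := by
  let e : ∀ i, {v : Fin L × Fin d // p + v.1 + v.2 = i} ≃
    {v : Fin d × Fin L // p + v.1 + v.2 = i} := fun i =>
    (Equiv.prodComm _ _).subtypeEquiv fun v => by simp; omega
  rw [← absDet_submatrix (stringBlock d L p i t) (e (i + t)) (e i)]
  congr 1
  ext ⟨⟨c', j'⟩, h'⟩ ⟨⟨c, j⟩, h⟩
  simp only at h h'
  simp only [stringBlock, Matrix.submatrix_apply, Matrix.of_apply, e, Equiv.subtypeEquiv_apply,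
    Equiv.prodComm_apply, Prod.swap_prod_mk]
  split_ifs with h1 h2 h2
  · rw [← Nat.choose_symm (by omega)]; congr 2; omega
  · rw [Nat.choose_eq_zero_of_lt (by omega)]; simp
  · rw [Nat.choose_eq_zero_of_lt (by omega)]; simp
  · rfl

theorem absDet_stringBlock_of_le_right {L d p i t : ℕ} (h : L + 2 * p + d = 2 * i + t + 2)
    (hd : p + L ≤ i + 1) : absDet (stringBlock L d p i t) = 1 := by
  rw [← stringBlock_swap]
  exact absDet_stringBlock_of_le_left (by omega) hd

theorem absDet_stringBlock {L d p i t s : ℕ} (h : L + 2 * p + d = 2 * i + t + 2)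
    (hs : s + i + 1 = p + d) (h1 : 1 ≤ s) (ht : s ≤ t - 1) :
    absDet (stringBlock L d p i t) = |((Cmat t s d).det : ℚ)| := by
  let e₁ : Fin (d - s) ≃ {v : Fin L × Fin d // p + v.1 + v.2 = i + t} :=
    { toFun := fun r => ⟨(⟨t - s + r, by omega⟩, ⟨d - 1 - r, by omega⟩), by simp only; omega⟩
      invFun := fun v => ⟨d - 1 - v.1.2, by have := v.2; have := v.1.1.2; have := v.1.2.2; omega⟩
      left_inv := fun r => by ext; simp; omega
      right_inv := fun v => by
        have := v.2; have := v.1.1.2; have := v.1.2.2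
        ext <;> simp <;> omega }
  let e₂ : Fin (d - s) ≃ {v : Fin L × Fin d // p + v.1 + v.2 = i} :=
    { toFun := fun r => ⟨(⟨i - p - r, by omega⟩, ⟨r, by omega⟩), by simp only; omega⟩
      invFun := fun v => ⟨v.1.2, by have := v.2; have := v.1.1.2; have := v.1.2.2; omega⟩
      left_inv := fun r => by ext; simp
      right_inv := fun v => by
        have := v.2; have := v.1.1.2; have := v.1.2.2
        ext <;> simp; omega }
  rw [← absDet_submatrix _ e₁ e₂, absDet_square]
  have : (stringBlock L d p i t).submatrix e₁ e₂ = (Int.castRingHom ℚ).mapMatrix (Cmat t s d) := by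
    ext r c
    simp only [stringBlock, Matrix.submatrix_apply, Matrix.of_apply, e₁, e₂, Equiv.coe_fn_mk,
      RingHom.mapMatrix_apply, Matrix.map_apply, Cmat, binomZ]
    split_ifs with h1 h2 h2
    · simp only [eq_intCast, Int.cast_natCast]
      congr 2; omega
    · omega
    · omega
    · simp
  rw [this, ← RingHom.map_det]
  simp

open Polynomial in
/-- A nonzero polynomial divisible by `(X + 1)^t` has more than `t` nonzero coefficients. -/
theorem lt_card_support_of_X_add_one_pow_dvd (t : ℕ) (f : ℚ[X]) (hf : f ≠ 0)
    (h : (X + 1) ^ t ∣ f) : t < f.support.card := by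
  induction t generalizing f with
  | zero => simpa [Finset.card_pos] using hf
  | succ t ih =>
    obtain ⟨m, hm⟩ : f.support.Nonempty := by simpa using hf
    set g : ℚ[X] := X * derivative f - C (m : ℚ) * f with hg
    have hcoeff : ∀ n, g.coeff n = ((n : ℚ) - m) * f.coeff n := by
      intro n
      cases n with
      | zero => simp [hg]
      | succ n => simp [hg, coeff_X_mul, coeff_derivative]; ring
    have hsupp : g.support = f.support.erase m := by
      ext n
      simp only [mem_support_iff, hcoeff, Finset.mem_erase, ne_eq, mul_eq_zero, not_or, sub_eq_zero,
        Nat.cast_inj]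
    have hg0 : g ≠ 0 := by
      intro hg0
      rw [hg0, support_zero, eq_comm, Finset.erase_eq_empty_iff] at hsupp
      have hs : f.support = {m} := by
        rcases hsupp with h' | h'
        · simp [h'] at hm
        · exact h'
      have hfm : f = C (f.coeff m) * X ^ m := by
        ext n
        rw [coeff_C_mul, coeff_X_pow]
        by_cases hn : n = m
        · simp [hn]
        · have : n ∉ f.support := by simp [hs, hn]
          simpa [hn] using this
      obtain ⟨q, hq⟩ := h
      have := congrArg (eval (-1)) hq
      rw [hfm] at this
      simp at this
      exact (mem_support_iff.mp hm) this
    have hdvd : (X + 1) ^ t ∣ g := by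
      obtain ⟨q, rfl⟩ := h
      refine dvd_sub (Dvd.dvd.mul_left ?_ _) (Dvd.dvd.mul_left ?_ _)
      · rw [derivative_mul, derivative_pow]
        refine dvd_add (Dvd.dvd.mul_right (Dvd.dvd.mul_right ?_ _) _) (Dvd.dvd.mul_right ?_ _)
        · simp
        · exact pow_dvd_pow _ (Nat.le_succ t)
      · exact Dvd.dvd.mul_right (pow_dvd_pow _ (Nat.le_succ t)) _
    have := ih g hg0 hdvd
    rw [hsupp, Finset.card_erase_of_mem hm] at this
    omega

open Polynomial in
theorem det_Cmat_ne_zero {t s d : ℕ} (hst : s < t) : (Cmat t s d).det ≠ 0 := by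
  intro h0
  have h1 : ((Int.castRingHom ℚ).mapMatrix (Cmat t s d)).det = 0 := by
    rw [← RingHom.map_det, h0, map_zero]
  obtain ⟨v, hv, hv0⟩ := Matrix.exists_mulVec_eq_zero_iff.mpr h1
  set f : ℚ[X] := ∑ c : Fin (d - s), C (v c) * X ^ (c : ℕ) with hf
  have hfcoeff : ∀ c : Fin (d - s), f.coeff c = v c := by
    intro c
    simp [hf, finsetSum_coeff, coeff_X_pow, ← Fin.ext_iff]
  have hf0 : f ≠ 0 := by
    intro h
    apply hv
    ext c
    simpa [h] using (hfcoeff c).symm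
  have hX : ((X : ℚ[X]) + 1) ^ t ≠ 0 := pow_ne_zero _ (by
    have := X_add_C_ne_zero (1 : ℚ); simpa using this)
  have hg0 : (X + 1) ^ t * f ≠ 0 := mul_ne_zero hX hf0
  have hcoeff : ∀ k, ((X + 1) ^ t * f).coeff k =
      ∑ c : Fin (d - s), if (c : ℕ) ≤ k then (t.choose (k - c) : ℚ) * v c else 0 := by
    intro k
    rw [hf, Finset.mul_sum, finsetSum_coeff]
    refine Finset.sum_congr rfl fun c _ => ?_
    rw [mul_left_comm, coeff_C_mul, coeff_mul_X_pow', coeff_X_add_one_pow]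
    split_ifs <;> ring
  have hsub : ((X + 1) ^ t * f).support ⊆ Finset.range (t + (d - s)) \ Finset.Ico s d := by
    intro k hk
    rw [mem_support_iff, hcoeff] at hk
    rw [Finset.mem_sdiff, Finset.mem_range, Finset.mem_Ico]
    constructor
    · by_contra hk'
      apply hk
      refine Finset.sum_eq_zero fun c _ => ?_
      rw [if_pos (by omega), Nat.choose_eq_zero_of_lt (by omega)]
      simp
    · rintro ⟨h2, h3⟩
      apply hk
      have := congrFun hv0 ⟨d - 1 - k, by omega⟩
      simp only [Matrix.mulVec, dotProduct, RingHom.mapMatrix_apply, Matrix.map_apply, Cmat,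
        Matrix.of_apply, binomZ, Pi.zero_apply] at this
      refine (Finset.sum_congr rfl fun c _ => ?_).trans this
      split_ifs with h4 h5 h5
      · simp only [eq_intCast, Int.cast_natCast]
        congr 3; omega
      · omega
      · omega
      · simp
  have hcard := lt_card_support_of_X_add_one_pow_dvd t _ hg0 (dvd_mul_right _ _)
  have := Finset.card_le_card hsub
  rw [Finset.card_sdiff_of_subset, Finset.card_range, Nat.card_Ico] at this
  · omega
  · intro x hx
    simp at hx ⊢
    omega

/-- The block of a matrix formed by the rows of degree `a` and the columns of degree `b`. -/
def degBlock {X Y R : Type*} (M : Matrix X Y R) (f : X → ℕ) (g : Y → ℕ) (a b : ℕ) :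
    Matrix {x // f x = a} {y // g y = b} R :=
  M.submatrix Subtype.val Subtype.val

/-- The matrix `M` is homogeneous of degree `k`. -/
def RaisesDegree {X Y R : Type*} [Zero R] (M : Matrix X Y R) (f : X → ℕ) (g : Y → ℕ) (k : ℕ) :
    Prop :=
  ∀ x y, f x ≠ g y + k → M x y = 0

theorem sum_subtype_of_ne_zero {Y R : Type*} [AddCommMonoid R] [Fintype Y] (p : Y → Prop)
    [DecidablePred p] (f : Y → R) (h : ∀ y, ¬ p y → f y = 0) :
    ∑ y : {y // p y}, f y = ∑ y, f y := by
  refine Fintype.sum_of_injective Subtype.val Subtype.val_injective _ _ ?_ fun _ => rfl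
  intro y hy
  apply h
  simpa using hy

theorem degBlock_mul {X Y Z R : Type*} [CommRing R] [Fintype Y] (M : Matrix X Y R)
    {N : Matrix Y Z R} {f : X → ℕ} {g : Y → ℕ} {h : Z → ℕ} {k : ℕ}
    (hN : RaisesDegree N g h k) (a c : ℕ) :
    degBlock (M * N) f h a c = degBlock M f g a (c + k) * degBlock N g h (c + k) c := by
  ext ⟨x, hx⟩ ⟨z, hz⟩
  simp only [degBlock, Matrix.submatrix_apply, Matrix.mul_apply]
  refine (sum_subtype_of_ne_zero (fun y => g y = c + k) (fun y => M x y * N y z) ?_).symm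
  intro y hy
  rw [hN y z (by rwa [hz]), mul_zero]

theorem RaisesDegree.pow {X R : Type*} [CommRing R] [Fintype X] [DecidableEq X]
    {N : Matrix X X R} {f : X → ℕ} {k : ℕ} (hN : RaisesDegree N f f k) (t : ℕ) :
    RaisesDegree (N ^ t) f f (t * k) := by
  induction t with
  | zero =>
    intro x y hxy
    rw [pow_zero, Matrix.one_apply_ne]
    rintro rfl
    simp at hxy
  | succ t ih =>
    intro x y hxy
    rw [pow_succ', Matrix.mul_apply]
    refine Finset.sum_eq_zero fun z _ => ?_
    by_cases h : f z = f y + t * k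
    · rw [hN x z, zero_mul]
      rw [h]
      intro h'
      apply hxy
      rw [h']; ring
    · rw [ih z y h, mul_zero]

theorem RaisesDegree.pow_one {X R : Type*} [CommRing R] [Fintype X] [DecidableEq X]
    {N : Matrix X X R} {f : X → ℕ} (hN : RaisesDegree N f f 1) (t : ℕ) :
    RaisesDegree (N ^ t) f f t := by
  simpa using hN.pow t

/-- Applying a matrix to a vector supported in a single degree. -/
theorem mulVec_eq_degBlock_mulVec {X Y R : Type*} [CommRing R] [Fintype Y] (M : Matrix X Y R)
    {f : X → ℕ} {g : Y → ℕ} {b : ℕ} {w : Y → R} (hw : ∀ y, g y ≠ b → w y = 0) (x : X) :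
    M.mulVec w x = (degBlock M f g (f x) b).mulVec (fun y => w y.1) ⟨x, rfl⟩ := by
  simp only [Matrix.mulVec, dotProduct, degBlock, Matrix.submatrix_apply]
  refine (sum_subtype_of_ne_zero (fun y => g y = b) (fun y => M x y * w y) ?_).symm
  intro y hy
  rw [hw y hy, mul_zero]

/-- `N` is the matrix of a degree one endomorphism of a graded vector space with homogeneous
basis `X`, living in degrees `0, …, E`, such that the maps `N^(E-2m)` between complementary
degrees `m` and `E - m` are isomorphisms. -/
structure IsLefschetz {X : Type} [Fintype X] [DecidableEq X] (deg : X → ℕ) (N : Matrix X X ℚ)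
    (E : ℕ) : Prop where
  deg_le : ∀ x, deg x ≤ E
  raisesDegree : RaisesDegree N deg deg 1
  absDet_ne_zero : ∀ m, 2 * m ≤ E → absDet (degBlock (N ^ (E - 2 * m)) deg deg (E - m) m) ≠ 0

/-- The vectors `w s`, for `s : S`, are homogeneous primitive elements of degree `p s`; they are
linearly independent in each degree `q ≤ E/2`, their number being the difference of the
dimensions in degrees `q` and `q - 1`. -/
structure IsPrimitiveBasis {X S : Type} [Fintype X] [DecidableEq X] [Fintype S] (deg : X → ℕ)
    (N : Matrix X X ℚ) (E : ℕ) (p : S → ℕ) (w : S → X → ℚ) : Prop where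
  two_mul_le : ∀ s, 2 * p s ≤ E
  eq_zero_of_deg_ne : ∀ s x, deg x ≠ p s → w s x = 0
  pow_mulVec : ∀ s, (N ^ (E + 1 - 2 * p s)).mulVec (w s) = 0
  eq_zero_of_sum : ∀ q (c : S → ℚ), (∀ s, p s ≠ q → c s = 0) → ∑ s, c s • w s = 0 → c = 0
  card_add : ∀ q, 2 * q ≤ E → Fintype.card {s // p s = q} + Fintype.card {x // deg x = E + 1 - q}
    = Fintype.card {x // deg x = q}

namespace IsLefschetz

variable {X : Type} [Fintype X] [DecidableEq X] {deg : X → ℕ} {N : Matrix X X ℚ} {E : ℕ}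

theorem nonempty_equiv (h : IsLefschetz deg N E) {m : ℕ} (hm : m ≤ E) :
    Nonempty ({x // deg x = m} ≃ {x // deg x = E - m}) := by
  rcases le_total (2 * m) E with h2 | h2
  · exact nonempty_equiv_of_absDet_ne_zero (h.absDet_ne_zero m h2)
  · obtain ⟨e⟩ := nonempty_equiv_of_absDet_ne_zero (h.absDet_ne_zero (E - m) (by omega))
    rw [show E - (E - m) = m by omega] at e
    exact ⟨e.symm⟩

theorem card_eq (h : IsLefschetz deg N E) {m : ℕ} (hm : m ≤ E) :
    Fintype.card {x // deg x = E - m} = Fintype.card {x // deg x = m} :=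
  let ⟨e⟩ := h.nonempty_equiv hm
  (Fintype.card_congr e).symm

theorem isEmpty_of_lt (h : IsLefschetz deg N E) {m : ℕ} (hm : E < m) :
    IsEmpty {x // deg x = m} :=
  ⟨fun x => by have := h.deg_le x.1; have := x.2; omega⟩

theorem surjective (h : IsLefschetz deg N E) {q : ℕ} (hq : 2 * q ≤ E) :
    Function.Surjective (degBlock (N ^ (E + 1 - 2 * q)) deg deg (E + 1 - q) q).mulVec := by
  rcases Nat.eq_zero_or_pos q with rfl | hpos
  · have := h.isEmpty_of_lt (m := E + 1 - 0) (by omega)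
    intro y
    exact ⟨0, Subsingleton.elim _ _⟩
  · obtain ⟨r, rfl⟩ : ∃ r, q = r + 1 := ⟨q - 1, by omega⟩
    have h1 := mulVec_surjective_of_absDet_ne_zero (h.absDet_ne_zero r (by omega))
    rw [show E - 2 * r = (E + 1 - 2 * (r + 1)) + 1 by omega, pow_succ,
      degBlock_mul _ h.raisesDegree, show E - r = E + 1 - (r + 1) by omega] at h1
    intro y
    obtain ⟨v, hv⟩ := h1 y
    exact ⟨_, by rw [← hv, ← Matrix.mulVec_mulVec]⟩

/-- The primitive elements of degree `q`. -/
noncomputable def primitive (deg : X → ℕ) (N : Matrix X X ℚ) (E q : ℕ) :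
    Submodule ℚ ({x // deg x = q} → ℚ) :=
  LinearMap.ker (degBlock (N ^ (E + 1 - 2 * q)) deg deg (E + 1 - q) q).mulVecLin

theorem finrank_primitive (h : IsLefschetz deg N E) {q : ℕ} (hq : 2 * q ≤ E) :
    Module.finrank ℚ (primitive deg N E q) + Fintype.card {x // deg x = E + 1 - q}
      = Fintype.card {x // deg x = q} := by
  have h1 := LinearMap.finrank_range_add_finrank_ker
    (degBlock (N ^ (E + 1 - 2 * q)) deg deg (E + 1 - q) q).mulVecLin
  rw [LinearMap.range_eq_top.mpr (h.surjective hq), finrank_top,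
    Module.finrank_fintype_fun_eq_card, Module.finrank_fintype_fun_eq_card] at h1
  rw [← h1, primitive, add_comm]

theorem exists_primitiveBasis (h : IsLefschetz deg N E) :
    ∃ (S : Type) (_ : Fintype S) (_ : DecidableEq S) (p : S → ℕ) (w : S → X → ℚ),
      IsPrimitiveBasis deg N E p w := by
  let b := fun q => Module.finBasis ℚ (primitive deg N E q)
  refine ⟨Σ q : Fin (E / 2 + 1), Fin (Module.finrank ℚ (primitive deg N E q)), inferInstance,
    inferInstance, fun s => s.1, fun s x => if hx : deg x = s.1 then (b s.1 s.2).1 ⟨x, hx⟩ else 0,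
    ?_, ?_, ?_, ?_, ?_⟩
  · intro s
    have := s.1.2
    change 2 * (s.1 : ℕ) ≤ E
    omega
  · intro s x hx
    exact dif_neg hx
  · intro s
    ext x
    rw [mulVec_eq_degBlock_mulVec (f := deg) (g := deg) (b := s.1) _ fun y hy => dif_neg hy]
    have hs := s.1.2
    have hb : (fun y : {y // deg y = s.1} => if hx : deg y.1 = s.1 then
        (b s.1 s.2).1 ⟨y.1, hx⟩ else 0) = (b s.1 s.2).1 := by
      ext y
      rw [dif_pos y.2]
    rw [hb]
    by_cases hx : deg x = E + 1 - s.1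
    · have h1 : (degBlock (N ^ (E + 1 - 2 * (s.1 : ℕ))) deg deg (E + 1 - s.1) s.1).mulVec
          (b s.1 s.2).1 = 0 := LinearMap.mem_ker.mp (b s.1 s.2).2
      exact congrFun h1 ⟨x, hx⟩
    · simp only [Matrix.mulVec, dotProduct, degBlock, Matrix.submatrix_apply, Pi.zero_apply]
      refine Finset.sum_eq_zero fun y _ => ?_
      rw [h.raisesDegree.pow_one _ _ _ (by have := y.2; omega), zero_mul]
  · intro q c hc hsum
    ext ⟨r, a⟩
    by_cases hr : (r : ℕ) = q
    swap
    · exact hc _ hr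
    subst hr
    have h1 : ∑ a, c ⟨r, a⟩ • b r a = 0 := by
      ext x
      have h2 := congrFun hsum x.1
      rw [Fintype.sum_sigma, Finset.sum_eq_single r] at h2
      · simp only [Finset.sum_apply, Pi.smul_apply, dif_pos x.2] at h2
        simpa using h2
      · intro r' _ hr'
        refine Finset.sum_eq_zero fun a _ => ?_
        rw [hc, zero_smul]
        exact fun h' => hr' (Fin.ext h')
      · simp
    exact Fintype.linearIndependent_iff.mp (b r).linearIndependent _ h1 a
  · intro q hq
    rw [← h.finrank_primitive hq]
    congr 1
    let r : Fin (E / 2 + 1) := ⟨q, by omega⟩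
    have e : {s : Σ q : Fin (E / 2 + 1), Fin (Module.finrank ℚ (primitive deg N E q)) //
        (s.1 : ℕ) = q} ≃ {s : Σ q : Fin (E / 2 + 1),
          Fin (Module.finrank ℚ (primitive deg N E q)) // s.1 = r} :=
      Equiv.subtypeEquivRight fun s => by simp [r, Fin.ext_iff]
    rw [Fintype.card_congr (e.trans (Equiv.sigmaSubtype r))]
    simp [r]

end IsLefschetz

/-- The degree of an element of a disjoint union of strings starting in degrees `p s`. -/
def stringDeg {S : Type} {L : S → ℕ} (p : S → ℕ) (u : Σ s, Fin (L s)) : ℕ := p u.1 + u.2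

/-- The matrix whose columns are the elements of the strings generated by the vectors `w s`. -/
def stringBasisMatrix {X S : Type} [Fintype X] [DecidableEq X] (N : Matrix X X ℚ) (L : S → ℕ)
    (w : S → X → ℚ) : Matrix X (Σ s, Fin (L s)) ℚ :=
  Matrix.of fun x u => (N ^ (u.2 : ℕ)).mulVec (w u.1) x

namespace IsPrimitiveBasis

variable {X S : Type} [Fintype X] [DecidableEq X] [Fintype S] {deg : X → ℕ}
  {N : Matrix X X ℚ} {E : ℕ} {p : S → ℕ} {w : S → X → ℚ}

theorem raisesDegree (hw : IsPrimitiveBasis deg N E p w) (hN : RaisesDegree N deg deg 1)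
    (L : S → ℕ) : RaisesDegree (stringBasisMatrix N L w) deg (stringDeg p) 0 := by
  intro x u hxu
  simp only [stringBasisMatrix, Matrix.of_apply, Matrix.mulVec, dotProduct]
  refine Finset.sum_eq_zero fun y _ => ?_
  by_cases hy : deg y = p u.1
  · rw [hN.pow_one _ _ _ (by rw [hy]; exact hxu), zero_mul]
  · rw [hw.eq_zero_of_deg_ne _ _ hy, mul_zero]

theorem mul_stringBasisMatrix [DecidableEq S] (hw : IsPrimitiveBasis deg N E p w) :
    N * stringBasisMatrix N (fun s => E + 1 - 2 * p s) w =
      stringBasisMatrix N (fun s => E + 1 - 2 * p s) w *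
        stringMatrix ℚ (fun s => E + 1 - 2 * p s) := by
  ext x ⟨s, c⟩
  have h1 : (N * stringBasisMatrix N (fun s => E + 1 - 2 * p s) w) x ⟨s, c⟩
      = (N ^ ((c : ℕ) + 1)).mulVec (w s) x := by
    rw [pow_succ', ← Matrix.mulVec_mulVec]
    rfl
  rw [h1, Matrix.mul_apply]
  by_cases hc : (c : ℕ) + 1 < E + 1 - 2 * p s
  · rw [Finset.sum_eq_single (⟨s, ⟨c + 1, hc⟩⟩ : Σ s, Fin (E + 1 - 2 * p s))]
    · simp [stringMatrix, stringBasisMatrix]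
    · rintro ⟨s', c'⟩ _ hne
      simp only [stringMatrix, Matrix.of_apply]
      rw [if_neg, mul_zero]
      rintro ⟨rfl, h⟩
      exact hne (by simp [Fin.ext_iff, h])
    · simp
  · have h2 : (c : ℕ) + 1 = E + 1 - 2 * p s := by have := c.2; omega
    rw [h2, hw.pow_mulVec]
    refine (Finset.sum_eq_zero ?_).symm
    rintro ⟨s', c'⟩ _
    simp only [stringMatrix, Matrix.of_apply]
    rw [if_neg, mul_zero]
    rintro ⟨rfl, h⟩
    have := c'.2
    omega

theorem card_le (hw : IsPrimitiveBasis deg N E p w) (h : IsLefschetz deg N E) (M : ℕ)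
    (hM : 2 * M ≤ E) : Fintype.card {s // p s ≤ M} = Fintype.card {x // deg x = M} := by
  classical
  induction M with
  | zero =>
    rw [← hw.card_add 0 (by omega)]
    have := h.isEmpty_of_lt (m := E + 1 - 0) (by omega)
    rw [Fintype.card_eq_zero (α := {x // deg x = E + 1 - 0}), add_zero]
    exact Fintype.card_congr (Equiv.subtypeEquivRight fun s => by omega)
  | succ M ih =>
    rw [← hw.card_add (M + 1) hM, show E + 1 - (M + 1) = E - M by omega, h.card_eq (by omega),
      ← ih (by omega), add_comm]
    simp only [Fintype.card_subtype]
    rw [← Finset.card_union_of_disjoint]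
    · congr 1
      ext s
      simp; omega
    · rw [Finset.disjoint_left]
      intro s hs
      simp at hs ⊢
      omega

theorem nonempty_equiv (hw : IsPrimitiveBasis deg N E p w) (h : IsLefschetz deg N E) (m : ℕ) :
    Nonempty ({u : Σ s, Fin (E + 1 - 2 * p s) // stringDeg p u = m} ≃ {x // deg x = m}) := by
  let e : {u : Σ s, Fin (E + 1 - 2 * p s) // stringDeg p u = m} ≃ {s // p s ≤ m ∧ m + p s ≤ E} :=
    { toFun := fun u => ⟨u.1.1, by have := u.2; have := u.1.2.2; unfold stringDeg at *; omega⟩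
      invFun := fun s => ⟨⟨s.1, ⟨m - p s.1, by have := s.2; omega⟩⟩, by
        have := s.2; unfold stringDeg; simp only; omega⟩
      left_inv := by
        rintro ⟨⟨s, c⟩, hu⟩
        simp only [stringDeg] at hu
        subst hu
        simp
      right_inv := fun s => rfl }
  rcases lt_or_ge E m with hm | hm
  · have := h.isEmpty_of_lt hm
    have : IsEmpty {s // p s ≤ m ∧ m + p s ≤ E} := ⟨fun s => by have := s.2; omega⟩
    exact ⟨e.trans (Equiv.equivOfIsEmpty _ _)⟩
  · refine Fintype.card_eq.mp ?_
    rw [Fintype.card_congr e]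
    rcases le_total (2 * m) E with h2 | h2
    · rw [← hw.card_le h m h2]
      exact Fintype.card_congr (Equiv.subtypeEquivRight fun s => by omega)
    · rw [← h.card_eq hm, ← hw.card_le h (E - m) (by omega)]
      exact Fintype.card_congr (Equiv.subtypeEquivRight fun s => by omega)

theorem absDet_ne_zero [DecidableEq S] (hw : IsPrimitiveBasis deg N E p w)
    (h : IsLefschetz deg N E) (m : ℕ) :
    absDet (degBlock (stringBasisMatrix N (fun s => E + 1 - 2 * p s) w) deg (stringDeg p) m m)
      ≠ 0 := by
  obtain ⟨e⟩ := hw.nonempty_equiv h m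
  refine absDet_ne_zero_of_injective _ e fun v hv => ?_
  by_contra hv0
  obtain ⟨u₁, hu₁⟩ : ∃ u, v u ≠ 0 := by
    by_contra! h'
    exact hv0 (funext h')
  obtain ⟨u₀, hu₀, hmin⟩ := Finset.exists_min_image
    (Finset.univ.filter fun u => v u ≠ 0) (fun u => p u.1.1) ⟨u₁, by simpa using hu₁⟩
  simp only [Finset.mem_filter, Finset.mem_univ, true_and] at hu₀ hmin
  obtain ⟨⟨s₀, c₀⟩, hd₀⟩ := u₀
  simp only [stringDeg] at hd₀ hmin
  have hc₀ := c₀.2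
  obtain ⟨q, hq⟩ : ∃ q, q = p s₀ := ⟨_, rfl⟩
  rw [← hq] at hmin
  let v' : (Σ s, Fin (E + 1 - 2 * p s)) → ℚ := fun u =>
    if hu : stringDeg p u = m then v ⟨u, hu⟩ else 0
  have hv'0 : ∀ u, stringDeg p u ≠ m → v' u = 0 := fun u hu => dif_neg hu
  have hv'lt : ∀ u, p u.1 < q → v' u = 0 := by
    intro u hu
    by_cases hum : stringDeg p u = m
    · rw [show v' u = v ⟨u, hum⟩ from dif_pos hum]
      by_contra hne
      exact absurd (hmin ⟨u, hum⟩ hne) (not_le.mpr hu)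
    · exact hv'0 u hum
  let P := stringBasisMatrix N (fun s => E + 1 - 2 * p s) w
  have hPv : P.mulVec v' = 0 := by
    ext x
    by_cases hx : deg x = m
    · rw [mulVec_eq_degBlock_mulVec (f := deg) (g := stringDeg p) (b := m) P hv'0]
      have : (fun y : {y // stringDeg p y = m} => v' y.1) = v := by
        ext y
        exact dif_pos y.2
      subst hx
      rw [this]
      exact congrFun hv ⟨x, rfl⟩
    · simp only [Matrix.mulVec, dotProduct, Pi.zero_apply]
      refine Finset.sum_eq_zero fun u _ => ?_
      by_cases hu : stringDeg p u = m
      · rw [show P x u = 0 from hw.raisesDegree h.raisesDegree _ x u (by rw [hu]; exact hx),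
          zero_mul]
      · rw [hv'0 u hu, mul_zero]
  let c : S → ℚ := fun s => if hs : p s = q then v' ⟨s, ⟨c₀, by omega⟩⟩ else 0
  have hsum : (N ^ (E - 2 * q)).mulVec (∑ s, c s • w s) = 0 := by
    have h1 : (N ^ (E - q - m)).mulVec (P.mulVec v') = 0 := by rw [hPv, Matrix.mulVec_zero]
    rw [← h1]
    have h2 : P.mulVec v' = ∑ u, v' u • (N ^ (u.2 : ℕ)).mulVec (w u.1) := by
      ext x
      simp [Matrix.mulVec, dotProduct, P, stringBasisMatrix, mul_comm]
    rw [h2, Matrix.mulVec_sum, Matrix.mulVec_sum, Fintype.sum_sigma]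
    refine Finset.sum_congr rfl fun s _ => ?_
    simp only [Matrix.mulVec_smul, Matrix.mulVec_mulVec, ← pow_add]
    by_cases hs : p s = q
    · rw [Finset.sum_eq_single (⟨c₀, by omega⟩ : Fin (E + 1 - 2 * p s))]
      · simp only [c, dif_pos hs]
        congr 3
        omega
      · intro c' _ hne
        rw [hv'0, zero_smul]
        intro h'
        apply hne
        simp only [stringDeg] at h'
        ext
        simp only
        omega
      · simp
    · simp only [c, dif_neg hs, zero_smul]
      refine (Finset.sum_eq_zero fun c' _ => ?_).symm
      by_cases hd : stringDeg p (⟨s, c'⟩ : Σ s, Fin (E + 1 - 2 * p s)) = m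
      · by_cases hlt : p s < q
        · rw [hv'lt _ hlt, zero_smul]
        · simp only [stringDeg] at hd
          have hs2 := hw.two_mul_le s
          obtain ⟨r, hr⟩ : ∃ r, E - q - m + (c' : ℕ) = r + (E + 1 - 2 * p s) :=
            ⟨E - q - m + c' - (E + 1 - 2 * p s), by omega⟩
          rw [hr, pow_add, ← Matrix.mulVec_mulVec, hw.pow_mulVec, Matrix.mulVec_zero, smul_zero]
      · rw [hv'0 _ hd, zero_smul]
  have hsupp : ∀ y, deg y ≠ q → (∑ s, c s • w s) y = 0 := by
    intro y hy
    rw [Finset.sum_apply]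
    refine Finset.sum_eq_zero fun s _ => ?_
    by_cases hs : p s = q
    · rw [Pi.smul_apply, hw.eq_zero_of_deg_ne s y (by rwa [hs]), smul_zero]
    · simp [c, hs]
  have hzero : ∑ s, c s • w s = 0 := by
    have h1 := mulVec_injective_of_absDet_ne_zero (h.absDet_ne_zero q (by omega))
      (fun y => (∑ s, c s • w s) y.1) (by
        ext ⟨x, hx⟩
        have h2 := congrFun hsum x
        rw [mulVec_eq_degBlock_mulVec (f := deg) (g := deg) _ hsupp] at h2
        generalize E - q = a at hx
        subst hx
        exact h2)
    ext y
    by_cases hy : deg y = q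
    · exact congrFun h1 ⟨y, hy⟩
    · exact hsupp y hy
  have hc := congrFun (hw.eq_zero_of_sum q c (fun s hs => dif_neg hs) hzero) s₀
  apply hu₀
  rw [Pi.zero_apply] at hc
  rw [← hc]
  simp only [c, dif_pos hq.symm]
  exact (show v' ⟨s₀, c₀⟩ = v ⟨⟨s₀, c₀⟩, hd₀⟩ from dif_pos hd₀).symm

end IsPrimitiveBasis

section TensorBlocks

variable {X Y : Type}

/-- The degree function on the basis of `V ⊗ k[z]/(z^d)`. -/
def tensorDeg {X : Type} (deg : X → ℕ) (d : ℕ) (u : X × Fin d) : ℕ := deg u.1 + u.2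

theorem RaisesDegree.tensorShift [Fintype X] [DecidableEq X] {N : Matrix X X ℚ} {deg : X → ℕ}
    (hN : RaisesDegree N deg deg 1)
    (d : ℕ) : RaisesDegree (tensorShift N d) (tensorDeg deg d) (tensorDeg deg d) 1 := by
  rintro ⟨x', j'⟩ ⟨x, j⟩ h
  rw [← _root_.pow_one (_root_.tensorShift N d), tensorShift_pow_apply]
  split_ifs with hj
  · rw [hN.pow_one, mul_zero]
    simp only [tensorDeg] at *
    omega
  · rfl

/-- The elements of degree `m` in `V ⊗ k[z]/(z^d)` with second factor `z^j`. -/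
def tensorFiberEquiv (deg : X → ℕ) {d m : ℕ} (j : Fin d) (hj : (j : ℕ) ≤ m) :
    {x // deg x = m - j} ≃ {a : {u // tensorDeg deg d u = m} // a.1.2 = j} where
  toFun x := ⟨⟨(x.1, j), by have := x.2; simp only [tensorDeg]; omega⟩, rfl⟩
  invFun a := ⟨a.1.1.1, by
    have := a.1.2; have h2 := congrArg Fin.val a.2; simp only [tensorDeg] at *; omega⟩
  left_inv x := rfl
  right_inv a := by
    obtain ⟨⟨⟨x, j'⟩, h⟩, rfl⟩ := a
    rfl

theorem isEmpty_tensorFiber (deg : X → ℕ) {d m : ℕ} (j : Fin d) (hj : ¬ (j : ℕ) ≤ m) :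
    IsEmpty {a : {u // tensorDeg deg d u = m} // a.1.2 = j} :=
  ⟨fun a => by
    have := a.1.2; have h2 := congrArg Fin.val a.2; simp only [tensorDeg] at *; omega⟩

open scoped Kronecker in
theorem absDet_degBlock_kronecker_one [Fintype Y] [DecidableEq Y] {P : Matrix X Y ℚ}
    {f : X → ℕ} {g : Y → ℕ}
    (he : ∀ m, Nonempty ({y // g y = m} ≃ {x // f x = m})) (d m : ℕ) :
    absDet (degBlock (P ⊗ₖ (1 : Matrix (Fin d) (Fin d) ℚ)) (tensorDeg f d) (tensorDeg g d) m m) =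
      ∏ j : Fin d, if (j : ℕ) ≤ m then absDet (degBlock P f g (m - j) (m - j)) else 1 := by
  rw [absDet_fiberwise _ (fun a => a.1.2) (fun a => a.1.2)]
  · refine Finset.prod_congr rfl fun j _ => ?_
    split_ifs with hj
    · rw [← absDet_submatrix _ (tensorFiberEquiv f j hj) (tensorFiberEquiv g j hj)]
      congr 1
      ext x y
      simp [degBlock, tensorFiberEquiv]
    · have := isEmpty_tensorFiber f j hj
      have := isEmpty_tensorFiber g j hj
      exact absDet_of_isEmpty _
  · rintro ⟨⟨x, j⟩, _⟩ ⟨⟨y, j'⟩, _⟩ h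
    simp only at h
    simp [degBlock, Matrix.one_apply_ne h]
  · intro j
    by_cases hj : (j : ℕ) ≤ m
    · exact ⟨(tensorFiberEquiv g j hj).symm.trans ((he _).some.trans (tensorFiberEquiv f j hj))⟩
    · have := isEmpty_tensorFiber f j hj
      have := isEmpty_tensorFiber g j hj
      exact ⟨Equiv.equivOfIsEmpty _ _⟩

theorem nonempty_tensorDeg_equiv {f : X → ℕ} {g : Y → ℕ}
    (he : ∀ m, Nonempty ({y // g y = m} ≃ {x // f x = m})) (d m : ℕ) :
    Nonempty ({v // tensorDeg g d v = m} ≃ {u // tensorDeg f d u = m}) := by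
  have key : ∀ j : Fin d, Nonempty ({a : {v // tensorDeg g d v = m} // a.1.2 = j} ≃
      {a : {u // tensorDeg f d u = m} // a.1.2 = j}) := by
    intro j
    by_cases hj : (j : ℕ) ≤ m
    · exact ⟨(tensorFiberEquiv g j hj).symm.trans ((he _).some.trans (tensorFiberEquiv f j hj))⟩
    · have := isEmpty_tensorFiber f j hj
      have := isEmpty_tensorFiber g j hj
      exact ⟨Equiv.equivOfIsEmpty _ _⟩
  exact ⟨(Equiv.sigmaFiberEquiv _).symm.trans
    ((Equiv.sigmaCongrRight fun j => (key j).some).trans (Equiv.sigmaFiberEquiv _))⟩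

end TensorBlocks

section Strings

variable {S : Type} [Fintype S] [DecidableEq S]

/-- The elements of degree `m` in a sum of tensor products of two strings, grouped by summand. -/
def stringFiberEquiv (p L : S → ℕ) (d m : ℕ) (s : S) :
    {v : Fin (L s) × Fin d // p s + v.1 + v.2 = m} ≃
      {a : {u : (Σ s, Fin (L s)) × Fin d // tensorDeg (stringDeg p) d u = m} // a.1.1.1 = s} where
  toFun v := ⟨⟨(⟨s, v.1.1⟩, v.1.2), v.2⟩, rfl⟩
  invFun a := ⟨(a.2 ▸ a.1.1.1.2, a.1.1.2), by
    obtain ⟨⟨⟨⟨s, c⟩, j⟩, h⟩, rfl⟩ := a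
    exact h⟩
  left_inv v := rfl
  right_inv a := by
    obtain ⟨⟨⟨⟨s, c⟩, j⟩, h⟩, rfl⟩ := a
    rfl

/-- The determinant of a block of the tensor product of two strings. -/
noncomputable def stringDet (d i t p : ℕ) : ℚ :=
  if p ≤ i ∧ i + 1 < p + d ∧ p + d < i + t + 1 then |((Cmat t (p + d - 1 - i) d).det : ℚ)| else 1

theorem absDet_stringBlock_eq_stringDet {L d p i t : ℕ} (h : L + 2 * p + d = 2 * i + t + 2) :
    absDet (stringBlock L d p i t) = stringDet d i t p := by
  unfold stringDet
  split_ifs with hc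
  · exact absDet_stringBlock h (by omega) (by omega) (by omega)
  · by_cases h1 : i < p
    · exact absDet_stringBlock_of_lt h h1
    · by_cases h2 : p + d ≤ i + 1
      · exact absDet_stringBlock_of_le_left h h2
      · exact absDet_stringBlock_of_le_right h (by omega)

theorem stringDet_ne_zero (d i t p : ℕ) : stringDet d i t p ≠ 0 := by
  unfold stringDet
  split_ifs with hc
  · simpa using det_Cmat_ne_zero (by omega)
  · exact one_ne_zero

theorem absDet_degBlock_tensorShift_stringMatrix {p L : S → ℕ} {d i t : ℕ}
    (h : ∀ s, L s + 2 * p s + d = 2 * i + t + 2) :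
    absDet (degBlock (tensorShift (stringMatrix ℚ L) d ^ t) (tensorDeg (stringDeg p) d)
      (tensorDeg (stringDeg p) d) (i + t) i) = ∏ s, stringDet d i t (p s) := by
  have hblock : ∀ s, absDet (stringBlock (L s) d (p s) i t) ≠ 0 := fun s => by
    rw [absDet_stringBlock_eq_stringDet (h s)]
    exact stringDet_ne_zero _ _ _ _
  rw [absDet_fiberwise _ (fun a => a.1.1.1) (fun a => a.1.1.1)]
  · refine Finset.prod_congr rfl fun s _ => ?_
    rw [← absDet_stringBlock_eq_stringDet (h s), ← absDet_submatrix _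
      (stringFiberEquiv p L d (i + t) s) (stringFiberEquiv p L d i s)]
    congr 1
    ext ⟨⟨c', j'⟩, h'⟩ ⟨⟨c, j⟩, h⟩
    simp only at h h'
    simp only [degBlock, stringFiberEquiv, stringBlock, Matrix.submatrix_apply, Matrix.of_apply,
      Equiv.coe_fn_mk, tensorShift_pow_apply, stringMatrix_pow_apply, true_and]
    by_cases hj : (j : ℕ) ≤ j'
    · by_cases hj' : (j' : ℕ) ≤ j + t
      · rw [if_pos ⟨hj, hj'⟩, if_pos hj, if_pos (by omega), mul_one]
      · rw [if_neg (by tauto), if_pos hj, Nat.choose_eq_zero_of_lt (by omega), Nat.cast_zero]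
    · rw [if_neg (by tauto), if_neg hj]
  · rintro ⟨⟨⟨s', c'⟩, j'⟩, h'⟩ ⟨⟨⟨s, c⟩, j⟩, h⟩ hs
    simp only at hs
    simp [degBlock, tensorShift_pow_apply, stringMatrix_pow_apply, hs]
  · intro s
    exact ⟨(stringFiberEquiv p L d i s).symm.trans
      ((nonempty_equiv_of_absDet_ne_zero (hblock s)).some.trans
        (stringFiberEquiv p L d (i + t) s))⟩

theorem prod_stringDet {T : Type} [Fintype T] (p : T → ℕ) (d i t : ℕ) :
    ∏ s, stringDet d i t (p s) =
      ∏ σ ∈ Finset.Icc (max 1 (d - i - 1)) (min (t - 1) (d - 1)),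
        |((Cmat t σ d).det : ℚ)| ^ Fintype.card {s // p s = i + σ - (d - 1)} := by
  simp only [stringDet]
  rw [Finset.prod_ite, Finset.prod_const_one, mul_one,
    ← Finset.prod_fiberwise_of_maps_to (t := Finset.Icc (max 1 (d - i - 1)) (min (t - 1) (d - 1)))
      (g := fun s => p s + d - 1 - i)]
  · refine Finset.prod_congr rfl fun σ hσ => ?_
    rw [Finset.prod_congr rfl (g := fun _ => |((Cmat t σ d).det : ℚ)|), Finset.prod_const,
      Fintype.card_subtype]
    · congr 2
      ext s
      simp only [Finset.mem_Icc, Finset.mem_filter, Finset.mem_univ, true_and] at hσ ⊢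
      omega
    · intro s hs
      rw [← (Finset.mem_filter.mp hs).2]
  · intro s hs
    simp only [Finset.mem_Icc, Finset.mem_filter, Finset.mem_univ, true_and] at hs ⊢
    omega

end Strings

/-- If `α` is an involution-antisymmetric positive function, the product of its values over an
interval only depends on the part which is not symmetric. -/
theorem prod_range_eq_prod_Icc_of_mul_eq_one {α : ℤ → ℚ} (hpos : ∀ m, 0 < α m) {E d i t : ℕ}
    (hd : 1 ≤ d) (hE : 2 * i + t + 1 = E + d) (hα : ∀ m, α (E - m) * α m = 1)
    (hneg : ∀ m < 0, α m = 1) :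
    ∏ j ∈ Finset.range d, α (i - j) = ∏ j ∈ Finset.Icc (d - t) (min i (d - 1)), α (i - j) := by
  rw [← Finset.prod_range_mul_prod_Ico _ (Nat.sub_le d t)]
  have h1 : ∏ j ∈ Finset.range (d - t), α (i - j) = 1 := by
    have h2 : (∏ j ∈ Finset.range (d - t), α (i - j)) *
        ∏ j ∈ Finset.range (d - t), α (i - j) = 1 := by
      nth_rewrite 1 [← Finset.prod_range_reflect]
      rw [← Finset.prod_mul_distrib]
      refine Finset.prod_eq_one fun j hj => ?_
      rw [Finset.mem_range] at hj
      rw [← hα (i - j)]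
      congr 2
      omega
    have h3 : 0 < ∏ j ∈ Finset.range (d - t), α (i - j) := Finset.prod_pos fun j _ => hpos _
    nlinarith
  rw [h1, one_mul]
  refine (Finset.prod_subset ?_ ?_).symm
  · intro j hj
    simp only [Finset.mem_Icc, Finset.mem_Ico] at *
    omega
  · intro j hj hj'
    simp only [Finset.mem_Icc, Finset.mem_Ico] at *
    exact hneg _ (by omega)

/-- The number of elements of degree `m`, which is zero for negative `m`. -/
def hilb {X : Type} [Fintype X] (deg : X → ℕ) (m : ℤ) : ℕ :=
  if 0 ≤ m then Fintype.card {x // deg x = m.toNat} else 0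

theorem pow_mul_eq_mul_pow {X Y R : Type*} [CommRing R] [Fintype X] [DecidableEq X] [Fintype Y]
    [DecidableEq Y] {A : Matrix X X R} {P : Matrix X Y R} {B : Matrix Y Y R} (h : A * P = P * B)
    (t : ℕ) : A ^ t * P = P * B ^ t := by
  induction t with
  | zero => simp
  | succ t ih => rw [pow_succ, Matrix.mul_assoc, h, ← Matrix.mul_assoc, ih, Matrix.mul_assoc,
      ← pow_succ]

open scoped Kronecker in
theorem tensorShift_mul_kronecker_one {X Y R : Type*} [CommRing R] [Fintype X] [DecidableEq X]
    [Fintype Y] [DecidableEq Y] {A : Matrix X X R} {P : Matrix X Y R} {B : Matrix Y Y R}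
    (h : A * P = P * B) (d : ℕ) :
    tensorShift A d * (P ⊗ₖ (1 : Matrix (Fin d) (Fin d) R)) =
      (P ⊗ₖ (1 : Matrix (Fin d) (Fin d) R)) * tensorShift B d := by
  simp only [tensorShift, Matrix.add_mul, Matrix.mul_add, ← Matrix.mul_kronecker_mul, h,
    Matrix.mul_one, Matrix.one_mul]

open scoped Kronecker in
theorem RaisesDegree.kronecker_one {X Y : Type} {P : Matrix X Y ℚ} {f : X → ℕ} {g : Y → ℕ}
    (hP : RaisesDegree P f g 0) (d : ℕ) :
    RaisesDegree (P ⊗ₖ (1 : Matrix (Fin d) (Fin d) ℚ)) (tensorDeg f d) (tensorDeg g d) 0 := by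
  rintro ⟨x, j⟩ ⟨y, j'⟩ h
  by_cases hj : j = j'
  · subst hj
    simp only [Matrix.kroneckerMap_apply]
    rw [hP, zero_mul]
    simp only [tensorDeg] at h
    omega
  · simp [Matrix.one_apply_ne hj]

theorem raisesDegree_stringMatrix {S : Type} [DecidableEq S] (p L : S → ℕ) :
    RaisesDegree (stringMatrix ℚ L) (stringDeg p) (stringDeg p) 1 := by
  rintro ⟨s', c'⟩ ⟨s, c⟩ h
  simp only [stringMatrix, Matrix.of_apply]
  rw [if_neg]
  rintro ⟨rfl, h'⟩
  simp only [stringDeg] at h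
  omega

namespace IsPrimitiveBasis

variable {X S : Type} [Fintype X] [DecidableEq X] [Fintype S] {deg : X → ℕ}
  {N : Matrix X X ℚ} {E : ℕ} {p : S → ℕ} {w : S → X → ℚ}

theorem card_eq_hilb_sub (hw : IsPrimitiveBasis deg N E p w) (h : IsLefschetz deg N E) {q : ℕ}
    (hq : 2 * q ≤ E) :
    (Fintype.card {s // p s = q} : ℤ) = (hilb deg q : ℤ) - hilb deg ((q : ℤ) - 1) := by
  have h1 : Fintype.card {x // deg x = E + 1 - q} = hilb deg ((q : ℤ) - 1) := by
    unfold hilb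
    rcases Nat.eq_zero_or_pos q with rfl | hpos
    · rw [if_neg (by omega), Fintype.card_eq_zero_iff]
      exact h.isEmpty_of_lt (by omega)
    · rw [if_pos (by omega), show ((q : ℤ) - 1).toNat = q - 1 by omega,
        show E + 1 - q = E - (q - 1) by omega,
        h.card_eq (by omega)]
  have h2 : Fintype.card {x // deg x = q} = hilb deg (q : ℤ) := by
    simp [hilb]
  have := hw.card_add q hq
  omega

variable [DecidableEq S]

theorem pow_mul_stringBasisMatrix (hw : IsPrimitiveBasis deg N E p w) (t : ℕ) :
    N ^ t * stringBasisMatrix N (fun s => E + 1 - 2 * p s) w =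
      stringBasisMatrix N (fun s => E + 1 - 2 * p s) w *
        stringMatrix ℚ (fun s => E + 1 - 2 * p s) ^ t :=
  pow_mul_eq_mul_pow hw.mul_stringBasisMatrix t

theorem degBlock_stringMatrix_pow (hw : IsPrimitiveBasis deg N E p w) {m : ℕ} (hm : 2 * m ≤ E) :
    absDet (degBlock (stringMatrix ℚ (fun s => E + 1 - 2 * p s) ^ (E - 2 * m)) (stringDeg p)
      (stringDeg p) (E - m) m) = 1 := by
  let e : {u : Σ s, Fin (E + 1 - 2 * p s) // stringDeg p u = m} ≃
      {u : Σ s, Fin (E + 1 - 2 * p s) // stringDeg p u = E - m} :=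
    { toFun := fun u => ⟨⟨u.1.1, ⟨u.1.2 + (E - 2 * m), by
          have := u.2; unfold stringDeg at this; omega⟩⟩, by
        have := u.2; unfold stringDeg at *; simp only; omega⟩
      invFun := fun u => ⟨⟨u.1.1, ⟨u.1.2 - (E - 2 * m), by omega⟩⟩, by
        have := u.2; have := u.1.2.2; have := hw.two_mul_le u.1.1
        unfold stringDeg at *; simp only; omega⟩
      left_inv := fun u => by simp
      right_inv := fun u => by
        obtain ⟨⟨s, c⟩, h⟩ := u
        have := c.2
        have := hw.two_mul_le s
        unfold stringDeg at h
        have hc : (c : ℕ) - (E - 2 * m) + (E - 2 * m) = c := by simp only at h; omega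
        simp [hc] }
  rw [absDet_eq _ e, show (degBlock (stringMatrix ℚ (fun s => E + 1 - 2 * p s) ^ (E - 2 * m))
    (stringDeg p) (stringDeg p) (E - m) m).submatrix e id = 1 from ?_]
  · simp
  ext ⟨⟨s', c'⟩, h'⟩ ⟨⟨s, c⟩, h⟩
  by_cases hs : s' = s
  · subst hs
    simp [degBlock, stringMatrix_pow_apply, e, Matrix.one_apply, Fin.ext_iff]
  · simp [degBlock, stringMatrix_pow_apply, e, hs]

/-- The determinants of `N^(E-2m)` are quotients of those of the change to the string basis. -/
theorem absDet_degBlock_pow_mul (hw : IsPrimitiveBasis deg N E p w) (h : IsLefschetz deg N E)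
    {m : ℕ} (hm : 2 * m ≤ E) :
    absDet (degBlock (N ^ (E - 2 * m)) deg deg (E - m) m) *
        absDet (degBlock (stringBasisMatrix N (fun s => E + 1 - 2 * p s) w) deg (stringDeg p) m m) =
      absDet (degBlock (stringBasisMatrix N (fun s => E + 1 - 2 * p s) w) deg (stringDeg p)
        (E - m) (E - m)) := by
  have hJ := hw.degBlock_stringMatrix_pow hm
  have h1 := congrArg (fun M => degBlock M deg (stringDeg p) (E - m) m)
    (hw.pow_mul_stringBasisMatrix (E - 2 * m))
  rw [degBlock_mul _ (hw.raisesDegree h.raisesDegree _), add_zero,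
    degBlock_mul _ ((raisesDegree_stringMatrix p _).pow_one _),
    show m + (E - 2 * m) = E - m by omega] at h1
  have h2 := congrArg absDet h1
  obtain ⟨e₁⟩ := hw.nonempty_equiv h m
  obtain ⟨e₂⟩ := hw.nonempty_equiv h (E - m)
  obtain ⟨e₃⟩ := nonempty_equiv_of_absDet_ne_zero (hJ.trans_ne one_ne_zero)
  obtain ⟨e₄⟩ := nonempty_equiv_of_absDet_ne_zero (h.absDet_ne_zero m hm)
  rwa [absDet_mul _ _ e₄ e₁, absDet_mul _ _ e₂ e₃, hJ, mul_one] at h2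

/-- The determinant of the change to the string basis in degree `m`. -/
noncomputable def basisDet (deg : X → ℕ) (N : Matrix X X ℚ) (E : ℕ) (p : S → ℕ) (w : S → X → ℚ)
    (m : ℤ) : ℚ :=
  if 0 ≤ m then absDet (degBlock (stringBasisMatrix N (fun s => E + 1 - 2 * p s) w) deg
    (stringDeg p) m.toNat m.toNat) else 1

theorem basisDet_natCast (m : ℕ) : basisDet deg N E p w m = absDet (degBlock (stringBasisMatrix N
    (fun s => E + 1 - 2 * p s) w) deg (stringDeg p) m m) := by
  simp [basisDet]

theorem basisDet_pos (hw : IsPrimitiveBasis deg N E p w) (h : IsLefschetz deg N E) (m : ℤ) :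
    0 < basisDet deg N E p w m := by
  unfold basisDet
  split_ifs
  · exact (absDet_nonneg _).lt_of_ne' (hw.absDet_ne_zero h _)
  · exact one_pos

theorem basisDet_of_lt (hw : IsPrimitiveBasis deg N E p w) (h : IsLefschetz deg N E) {m : ℤ}
    (hm : E < m) : basisDet deg N E p w m = 1 := by
  rw [basisDet, if_pos (by omega)]
  have := h.isEmpty_of_lt (m := m.toNat) (by omega)
  have := (hw.nonempty_equiv h m.toNat).some.isEmpty
  exact absDet_of_isEmpty _

open scoped Kronecker in
theorem absDet_tensorShift_mul (hw : IsPrimitiveBasis deg N E p w) (h : IsLefschetz deg N E)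
    {d i t : ℕ} (hE : 2 * i + t + 1 = E + d) :
    absDet (degBlock (tensorShift N d ^ t) (tensorDeg deg d) (tensorDeg deg d) (i + t) i) *
        ∏ j ∈ Finset.range d, basisDet deg N E p w (i - j) =
      (∏ j ∈ Finset.range d, basisDet deg N E p w ((i + t : ℕ) - j)) *
        ∏ s, stringDet d i t (p s) := by
  have hL : ∀ s, (E + 1 - 2 * p s) + 2 * p s + d = 2 * i + t + 2 := fun s => by
    have := hw.two_mul_le s
    omega
  have hJ := absDet_degBlock_tensorShift_stringMatrix (p := p) hL
  have hJ0 : ∏ s, stringDet d i t (p s) ≠ 0 :=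
    Finset.prod_ne_zero_iff.mpr fun s _ => stringDet_ne_zero _ _ _ _
  have h1 := congrArg
    (fun M => degBlock M (tensorDeg deg d) (tensorDeg (stringDeg p) d) (i + t) i)
    (pow_mul_eq_mul_pow (tensorShift_mul_kronecker_one hw.mul_stringBasisMatrix d) t)
  have hP : ∀ m, absDet (degBlock (stringBasisMatrix N (fun s => E + 1 - 2 * p s) w ⊗ₖ
      (1 : Matrix (Fin d) (Fin d) ℚ)) (tensorDeg deg d) (tensorDeg (stringDeg p) d) m m) =
      ∏ j ∈ Finset.range d, basisDet deg N E p w ((m : ℤ) - j) := by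
    intro m
    rw [absDet_degBlock_kronecker_one (hw.nonempty_equiv h), Finset.prod_range]
    refine Finset.prod_congr rfl fun j _ => ?_
    unfold basisDet
    by_cases hj : (j : ℕ) ≤ m
    · rw [if_pos hj, if_pos (by omega), show ((m : ℤ) - (j : ℕ)).toNat = m - j by omega]
    · rw [if_neg hj, if_neg (by omega)]
  rw [degBlock_mul _ ((hw.raisesDegree h.raisesDegree _).kronecker_one d), add_zero,
    degBlock_mul _ (((raisesDegree_stringMatrix p _).tensorShift d).pow_one _)] at h1
  have h2 := congrArg absDet h1
  obtain ⟨e₁⟩ := nonempty_tensorDeg_equiv (hw.nonempty_equiv h) d i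
  obtain ⟨e₂⟩ := nonempty_tensorDeg_equiv (hw.nonempty_equiv h) d (i + t)
  obtain ⟨e₃⟩ := nonempty_equiv_of_absDet_ne_zero (hJ.trans_ne hJ0)
  rwa [absDet_mul _ _ (e₁.symm.trans (e₃.trans e₂)) e₁, absDet_mul _ _ e₂ e₃, hJ, hP, hP] at h2

end IsPrimitiveBasis

namespace IsLefschetz

variable {X : Type} [Fintype X] [DecidableEq X] {deg : X → ℕ} {N : Matrix X X ℚ} {E : ℕ}

theorem absDet_tensorShift (h : IsLefschetz deg N E) {d i t : ℕ} (hd : 1 ≤ d)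
    (hE : 2 * i + t + 1 = E + d) :
    absDet (degBlock (tensorShift N d ^ t) (tensorDeg deg d) (tensorDeg deg d) (i + t) i) =
      (∏ j ∈ Finset.Icc (d - t) (min i (d - 1)),
        absDet (degBlock (N ^ (E - 2 * (i - j))) deg deg (E - (i - j)) (i - j))) *
      ∏ s ∈ Finset.Icc (max 1 (d - i - 1)) (min (t - 1) (d - 1)),
        |((Cmat t s d).det : ℚ)| ^
          ((hilb deg ((i : ℤ) + s - ((d : ℤ) - 1)) : ℤ) - hilb deg ((i : ℤ) + s - d)) := by
  obtain ⟨S, _, _, p, w, hw⟩ := h.exists_primitiveBasis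
  have hmul := hw.absDet_tensorShift_mul h hE
  set ρ := IsPrimitiveBasis.basisDet deg N E p w with hρ
  have hpos : ∀ m, 0 < ρ m := hw.basisDet_pos h
  have hrefl : ∏ j ∈ Finset.range d, ρ ((i + t : ℕ) - j) =
      ∏ j ∈ Finset.range d, ρ (E - (i - j)) := by
    rw [← Finset.prod_range_reflect]
    refine Finset.prod_congr rfl fun j hj => ?_
    rw [Finset.mem_range] at hj
    congr 1
    omega
  have hquot := prod_range_eq_prod_Icc_of_mul_eq_one (α := fun m => ρ (E - m) / ρ m)
    (fun m => div_pos (hpos _) (hpos _)) hd hE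
    (fun m => by
      have := (hpos m).ne'
      have := (hpos (E - m)).ne'
      simp only [sub_sub_cancel]
      field_simp)
    (fun m hm => by
      have h1 : ρ (E - m) = 1 := hw.basisDet_of_lt h (by omega)
      have h2 : ρ m = 1 := if_neg (by omega)
      simp [h1, h2])
  rw [Finset.prod_div_distrib] at hquot
  have hne : ∏ j ∈ Finset.range d, ρ (i - j) ≠ 0 :=
    Finset.prod_ne_zero_iff.mpr fun j _ => (hpos _).ne'
  rw [hrefl, mul_comm (∏ j ∈ Finset.range d, ρ (E - (i - j))), ← eq_div_iff hne, mul_div_assoc,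
    hquot, mul_comm, prod_stringDet] at hmul
  rw [hmul]
  congr 1
  · refine Finset.prod_congr rfl fun j hj => ?_
    rw [Finset.mem_Icc] at hj
    have hm : 2 * (i - j) ≤ E := by omega
    rw [div_eq_iff (hpos _).ne', show (i : ℤ) - j = (i - j : ℕ) by omega,
      show (E : ℤ) - (i - j : ℕ) = (E - (i - j) : ℕ) by omega, hρ,
      IsPrimitiveBasis.basisDet_natCast, IsPrimitiveBasis.basisDet_natCast,
      hw.absDet_degBlock_pow_mul h hm]
  · refine Finset.prod_congr rfl fun s hs => ?_
    rw [Finset.mem_Icc] at hs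
    have h1 := hw.card_eq_hilb_sub h (q := i + s - (d - 1)) (by omega)
    rw [← zpow_natCast, h1,
      show ((i + s - (d - 1) : ℕ) : ℤ) = (i : ℤ) + s - ((d : ℤ) - 1) by omega,
      show (i : ℤ) + s - ((d : ℤ) - 1) - 1 = (i : ℤ) + s - d by omega]

/-- The tensor product of a Lefschetz module with `k[z]/(z^d)` is a Lefschetz module. -/
theorem tensorShift (h : IsLefschetz deg N E) {d : ℕ} (hd : 1 ≤ d) :
    IsLefschetz (tensorDeg deg d) (tensorShift N d) (E + (d - 1)) where
  deg_le u := by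
    have := h.deg_le u.1
    have := u.2.2
    unfold tensorDeg
    omega
  raisesDegree := h.raisesDegree.tensorShift d
  absDet_ne_zero i hi := by
    have h1 := h.absDet_tensorShift hd (i := i) (t := E + (d - 1) - 2 * i) (by omega)
    rw [show E + (d - 1) - i = i + (E + (d - 1) - 2 * i) by omega, h1]
    refine mul_ne_zero (Finset.prod_ne_zero_iff.mpr fun j hj => ?_)
      (Finset.prod_ne_zero_iff.mpr fun s hs => zpow_ne_zero _ ?_)
    · rw [Finset.mem_Icc] at hj
      exact h.absDet_ne_zero _ (by omega)
    · rw [Finset.mem_Icc] at hs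
      simpa using det_Cmat_ne_zero (by omega)

end IsLefschetz

/-- The matrix of multiplication by `x₁ + ⋯ + xₙ` on `R[x₁,…,xₙ]/(x₁^{d₁},…,xₙ^{dₙ})` in the
monomial basis. -/
def ciShift (R : Type*) [CommRing R] {n : ℕ} (dv : Fin n → ℕ) :
    Matrix (∀ j, Fin (dv j)) (∀ j, Fin (dv j)) R :=
  Matrix.of fun b a => ∑ j, if (b j : ℕ) = a j + 1 ∧ ∀ m, m ≠ j → b m = a m then 1 else 0

/-- The degree of a monomial. -/
def ciDeg {n : ℕ} (dv : Fin n → ℕ) (a : ∀ j, Fin (dv j)) : ℕ := ∑ j, (a j : ℕ)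

/-- Splitting off the last exponent of a monomial. -/
def ciSplit {n : ℕ} (dv : Fin (n + 1) → ℕ) :
    (∀ j : Fin n, Fin (dv j.castSucc)) × Fin (dv (Fin.last n)) ≃ ∀ j, Fin (dv j) :=
  (Equiv.prodComm _ _).trans (Fin.snocEquiv fun j => Fin (dv j))

@[simp] theorem ciSplit_castSucc {n : ℕ} (dv : Fin (n + 1) → ℕ)
    (u : (∀ j : Fin n, Fin (dv j.castSucc)) × Fin (dv (Fin.last n))) (j : Fin n) :
    ciSplit dv u j.castSucc = u.1 j := by
  simp [ciSplit, Fin.snocEquiv]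

@[simp] theorem ciSplit_last {n : ℕ} (dv : Fin (n + 1) → ℕ)
    (u : (∀ j : Fin n, Fin (dv j.castSucc)) × Fin (dv (Fin.last n))) :
    ciSplit dv u (Fin.last n) = u.2 := by
  simp [ciSplit, Fin.snocEquiv]

theorem ciDeg_ciSplit {n : ℕ} (dv : Fin (n + 1) → ℕ)
    (u : (∀ j : Fin n, Fin (dv j.castSucc)) × Fin (dv (Fin.last n))) :
    ciDeg dv (ciSplit dv u) =
      tensorDeg (ciDeg fun j : Fin n => dv j.castSucc) (dv (Fin.last n)) u := by
  simp [ciDeg, tensorDeg, Fin.sum_univ_castSucc]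

theorem submatrix_pow_equiv {X Y R : Type*} [CommRing R] [Fintype X] [DecidableEq X] [Fintype Y]
    [DecidableEq Y] (M : Matrix X X R) (e : Y ≃ X) (t : ℕ) :
    (M ^ t).submatrix e e = M.submatrix e e ^ t := by
  induction t with
  | zero => simp
  | succ t ih => rw [pow_succ, pow_succ, ← ih, Matrix.submatrix_mul_equiv]

theorem ciShift_submatrix_ciSplit (R : Type*) [CommRing R] {n : ℕ} (dv : Fin (n + 1) → ℕ) :
    (ciShift R dv).submatrix (ciSplit dv) (ciSplit dv) =
      tensorShift (ciShift R fun j : Fin n => dv j.castSucc) (dv (Fin.last n)) := by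
  ext ⟨b, y⟩ ⟨a, x⟩
  simp only [ciShift, Matrix.submatrix_apply, Matrix.of_apply, Fin.sum_univ_castSucc,
    ciSplit_castSucc, ciSplit_last, tensorShift, Matrix.add_apply, Matrix.kroneckerMap_apply,
    shiftMatrix, Finset.sum_mul]
  congr 1
  · refine Finset.sum_congr rfl fun j _ => ?_
    rw [Matrix.one_apply, ite_zero_mul_ite_zero, mul_one]
    refine if_congr ?_ rfl rfl
    constructor
    · rintro ⟨h1, h2⟩
      refine ⟨⟨h1, fun m hm => ?_⟩, ?_⟩
      · simpa using h2 m.castSucc (by simpa using hm)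
      · simpa using h2 (Fin.last n) (Fin.castSucc_lt_last j).ne'
    · rintro ⟨⟨h1, h2⟩, h3⟩
      refine ⟨h1, fun m hm => ?_⟩
      induction m using Fin.lastCases with
      | last => simpa using h3
      | cast m => simpa using h2 m (by simpa using hm)
  · rw [Matrix.one_apply, ite_zero_mul_ite_zero, mul_one]
    refine if_congr ?_ rfl rfl
    rw [and_comm]
    refine and_congr_left fun _ => ?_
    constructor
    · intro h
      ext m
      simpa [Fin.ext_iff] using h m.castSucc (Fin.castSucc_lt_last m).ne
    · rintro rfl m hm
      induction m using Fin.lastCases with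
      | last => exact absurd rfl hm
      | cast m => simp

theorem multinomial_univ_castSucc {n : ℕ} (f : Fin (n + 1) → ℕ) :
    Nat.multinomial Finset.univ f =
      (∑ j, f j).choose (f (Fin.last n)) *
        Nat.multinomial Finset.univ fun j : Fin n => f j.castSucc := by
  have h1 := Nat.multinomial_spec Finset.univ f
  have h2 := Nat.multinomial_spec Finset.univ fun j : Fin n => f j.castSucc
  have h3 := Nat.add_choose_mul_factorial_mul_factorial (∑ j : Fin n, f j.castSucc) (f (Fin.last n))
  rw [Fin.prod_univ_castSucc] at h1
  rw [Fin.sum_univ_castSucc] at *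
  have h4 : 0 < (∏ j : Fin n, (f j.castSucc).factorial) * (f (Fin.last n)).factorial :=
    Nat.mul_pos (Finset.prod_pos fun _ _ => Nat.factorial_pos _) (Nat.factorial_pos _)
  apply Nat.eq_of_mul_eq_mul_left h4
  rw [h1, ← h3, ← h2]
  ring

theorem ciShift_pow_apply (R : Type*) [CommRing R] {n : ℕ} (dv : Fin n → ℕ) (t : ℕ)
    (b a : ∀ j, Fin (dv j)) :
    (ciShift R dv ^ t) b a = if (∀ j, (a j : ℕ) ≤ b j) ∧ ciDeg dv b = ciDeg dv a + t then
      (Nat.multinomial Finset.univ fun j => (b j : ℕ) - a j : R) else 0 := by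
  induction n generalizing t with
  | zero =>
    obtain rfl : b = a := Subsingleton.elim _ _
    rcases Nat.eq_zero_or_pos t with rfl | ht
    · simp [ciDeg]
    · rw [show ciShift R dv = 0 by ext; simp [ciShift], zero_pow ht.ne', if_neg (by omega)]
      rfl
  | succ n ih =>
    obtain ⟨⟨b, y⟩, rfl⟩ := (ciSplit dv).surjective b
    obtain ⟨⟨a, x⟩, rfl⟩ := (ciSplit dv).surjective a
    rw [← Matrix.submatrix_apply (ciShift R dv ^ t) (ciSplit dv) (ciSplit dv), submatrix_pow_equiv,
      ciShift_submatrix_ciSplit, tensorShift_pow_apply, ih, ciDeg_ciSplit, ciDeg_ciSplit]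
    simp only [tensorDeg, Fin.forall_fin_succ', ciSplit_castSucc, ciSplit_last]
    by_cases hab : ∀ j, (a j : ℕ) ≤ b j
    swap
    · simp only [hab, false_and, if_false, mul_zero, ite_self]
    by_cases hxy : (x : ℕ) ≤ y
    swap
    · simp [hxy]
    have hle : ciDeg (fun j : Fin n => dv j.castSucc) a ≤
        ciDeg (fun j : Fin n => dv j.castSucc) b :=
      Finset.sum_le_sum fun j _ => hab j
    by_cases hdeg : ciDeg (fun j : Fin n => dv j.castSucc) b + y
        = ciDeg (fun j : Fin n => dv j.castSucc) a + x + t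
    · rw [if_pos (by omega), if_pos ⟨hab, by omega⟩, if_pos ⟨⟨hab, hxy⟩, by omega⟩,
        multinomial_univ_castSucc, Fin.sum_univ_castSucc]
      simp only [ciSplit_castSucc, ciSplit_last]
      rw [Finset.sum_tsub_distrib _ fun j _ => hab j]
      push_cast
      congr 3
      unfold ciDeg at *
      omega
    · rw [if_neg (c := _ ∧ _ + _ = _) (by omega)]
      split_ifs
      · omega
      · simp
      · rfl

theorem absDet_degBlock_submatrix {X Y : Type} [Fintype X] [DecidableEq X] [Fintype Y]
    [DecidableEq Y] (M : Matrix X X ℚ) {deg : X → ℕ} {deg' : Y → ℕ} (e : Y ≃ X)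
    (he : ∀ y, deg (e y) = deg' y) (a b : ℕ) :
    absDet (degBlock (M.submatrix e e) deg' deg' a b) = absDet (degBlock M deg deg a b) :=
  absDet_submatrix (degBlock M deg deg a b) (e.subtypeEquiv fun y => by rw [he])
    (e.subtypeEquiv fun y => by rw [he])

theorem IsLefschetz.of_equiv {X Y : Type} [Fintype X] [DecidableEq X] [Fintype Y]
    [DecidableEq Y] {N : Matrix X X ℚ} {deg : X → ℕ} {E : ℕ} {deg' : Y → ℕ}
    (e : Y ≃ X) (he : ∀ y, deg (e y) = deg' y) (h : IsLefschetz deg' (N.submatrix e e) E) :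
    IsLefschetz deg N E where
  deg_le x := by simpa [← he] using h.deg_le (e.symm x)
  raisesDegree x y hxy := by
    simpa using h.raisesDegree (e.symm x) (e.symm y) (by simpa [← he] using hxy)
  absDet_ne_zero m hm := by
    rw [← absDet_degBlock_submatrix _ e he, submatrix_pow_equiv]
    exact h.absDet_ne_zero m hm

/-- Monomial complete intersections have the strong Lefschetz property over `ℚ`. -/
theorem isLefschetz_ciShift {n : ℕ} (dv : Fin n → ℕ) (hdv : ∀ j, 1 ≤ dv j) :
    IsLefschetz (ciDeg dv) (ciShift ℚ dv) (∑ j, (dv j - 1)) := by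
  induction n with
  | zero =>
    refine ⟨fun _ => by simp [ciDeg], fun x y _ => by simp [ciShift], fun m hm => ?_⟩
    obtain rfl : m = 0 := by simpa using hm
    rw [show ∑ j, (dv j - 1) = 0 by simp]
    change absDet (degBlock (1 : Matrix _ _ ℚ) (ciDeg dv) (ciDeg dv) 0 0) ≠ 0
    rw [absDet_square, show degBlock (1 : Matrix _ _ ℚ) (ciDeg dv) (ciDeg dv) 0 0 = 1 by
      ext x y; simp [degBlock, Matrix.one_apply, Subtype.ext_iff]]
    simp
  | succ n ih =>
    refine IsLefschetz.of_equiv (ciSplit dv) (ciDeg_ciSplit dv) ?_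
    rw [ciShift_submatrix_ciSplit, Fin.sum_univ_castSucc]
    exact (ih _ fun j => hdv _).tensorShift (hdv _)

theorem ciHilb_eq_hilb {n : ℕ} (dv : Fin n → ℕ) (j : ℤ) : ciHilb dv j = hilb (ciDeg dv) j := by
  unfold ciHilb hilb
  split_ifs
  · exact Fintype.card_congr (Equiv.refl _)
  · rfl

theorem ciDetAbs_eq_absDet {n : ℕ} (dv : Fin n → ℕ) {i : ℕ} (hi : 2 * i ≤ ∑ j, (dv j - 1)) :
    ciDetAbs dv i = absDet (degBlock (ciShift ℚ dv ^ (∑ j, (dv j - 1) - 2 * i)) (ciDeg dv)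
      (ciDeg dv) (∑ j, (dv j - 1) - i) i) := by
  have he : ∀ m, ∃ e : monIdx dv m ≃ {a // ciDeg dv a = m}, ∀ a, (e a).1 = a.1 :=
    fun m => ⟨Equiv.refl _, fun _ => rfl⟩
  obtain ⟨e₁, he₁⟩ := he (∑ j, (dv j - 1) - i)
  obtain ⟨e₂, he₂⟩ := he i
  rw [ciDetAbs, dif_pos (by omega), ← absDet_submatrix _ e₁ e₂,
    absDet_eq _ (monCompl dv i (by omega)),
    Int.cast_det]
  congr 2
  ext a' a
  have hb := (monCompl dv i (by omega) a').2
  have ha := a.2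
  simp only [ciMatrix, degBlock, Matrix.submatrix_apply, Matrix.map_apply, Matrix.of_apply,
    ciShift_pow_apply, he₁, he₂, id]
  by_cases hab : ∀ j, (a.1 j : ℕ) ≤ (monCompl dv i (by omega) a').1 j
  · rw [if_pos hab, if_pos ⟨hab, by unfold ciDeg; omega⟩]
    simp
  · rw [if_neg hab, if_neg (by tauto)]
    simp

theorem ciDetAbs_succ {n : ℕ} (dv : Fin (n + 1) → ℕ) (hdv : ∀ j, 1 ≤ dv j) {i : ℕ}
    (hi : 2 * i ≤ ∑ j, (dv j - 1)) :
    ciDetAbs dv i =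
      (∏ j ∈ Finset.Icc (dv (Fin.last n) - (∑ j, (dv j - 1) - 2 * i)) (min i (dv (Fin.last n) - 1)),
        ciDetAbs (fun m : Fin n => dv m.castSucc) (i - j)) *
      ∏ s ∈ Finset.Icc (max 1 (dv (Fin.last n) - i - 1))
          (min ((∑ j, (dv j - 1)) - 2 * i - 1) (dv (Fin.last n) - 1)),
        |((Cmat (∑ j, (dv j - 1) - 2 * i) s (dv (Fin.last n))).det : ℚ)| ^
          ((ciHilb (fun m : Fin n => dv m.castSucc)
              ((i : ℤ) + s - ((dv (Fin.last n) : ℤ) - 1)) : ℤ)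
            - (ciHilb (fun m : Fin n => dv m.castSucc)
              ((i : ℤ) + s - (dv (Fin.last n) : ℤ)) : ℤ)) := by
  have h := isLefschetz_ciShift (fun m : Fin n => dv m.castSucc) fun j => hdv _
  have hd := hdv (Fin.last n)
  have hsum := Fin.sum_univ_castSucc fun j => dv j - 1
  have key := h.absDet_tensorShift hd (i := i) (t := ∑ j, (dv j - 1) - 2 * i) (by omega)
  rw [ciDetAbs_eq_absDet dv hi, ← absDet_degBlock_submatrix _ (ciSplit dv) (ciDeg_ciSplit dv),
    submatrix_pow_equiv,
    ciShift_submatrix_ciSplit, show ∑ j, (dv j - 1) - i = i + (∑ j, (dv j - 1) - 2 * i) by omega]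
  rw [key]
  simp only [ciHilb_eq_hilb]
  congr 1
  refine Finset.prod_congr rfl fun j hj => ?_
  rw [Finset.mem_Icc] at hj
  rw [ciDetAbs_eq_absDet _ (by omega)]

theorem ciDetAbs_ne_zero {n : ℕ} (dv : Fin n → ℕ) (hdv : ∀ j, 1 ≤ dv j) {i : ℕ}
    (hi : 2 * i ≤ ∑ j, (dv j - 1)) : ciDetAbs dv i ≠ 0 := by
  rw [ciDetAbs_eq_absDet dv hi]
  exact (isLefschetz_ciShift dv hdv).absDet_ne_zero i hi

theorem ciDetAbs_fin_one (d : Fin 1 → ℕ) {i : ℕ} (hi : 2 * i ≤ ∑ j, (d j - 1)) :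
    ciDetAbs d i = 1 := by
  by_cases hd : 1 ≤ d 0
  · have hsum : ∑ j : Fin (0 + 1), (d j - 1) = d 0 - 1 := by simp
    rw [ciDetAbs_succ (n := 0) d
      (fun j => by rwa [show j = 0 from Subsingleton.elim (α := Fin 1) j 0]) hi,
      Finset.prod_eq_one, one_mul, Finset.prod_eq_one]
    · intro s hs
      rw [Finset.mem_Icc, hsum, show Fin.last 0 = 0 from rfl] at hs
      rw [hsum] at hi
      omega
    · intro j hj
      rw [Finset.mem_Icc, hsum, show Fin.last 0 = 0 from rfl] at hj
      rw [hsum] at hi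
      omega
  · rw [ciDetAbs_eq_absDet d hi]
    have : ∀ m, IsEmpty {a // ciDeg d a = m} := fun m => ⟨fun a => by
      have := (a.1 0).2
      omega⟩
    exact absDet_of_isEmpty _

section FieldCoefficients

variable {k : Type} [Field k] {n : ℕ} {dv : Fin n → ℕ}

theorem ciShift_pow_mulVec_of_ne {t m : ℕ} {v : (∀ j, Fin (dv j)) → k}
    (hv : ∀ a, ciDeg dv a ≠ m → v a = 0) (b : ∀ j, Fin (dv j)) (hb : ciDeg dv b ≠ m + t) :
    (ciShift k dv ^ t).mulVec v b = 0 := by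
  simp only [Matrix.mulVec, dotProduct]
  refine Finset.sum_eq_zero fun a _ => ?_
  rw [ciShift_pow_apply]
  by_cases ha : ciDeg dv a = m
  · rw [if_neg (by rw [ha]; tauto), zero_mul]
  · rw [hv a ha, mul_zero]

/-- The matrix of `ℓ^(e-2m)` between complementary degrees is invertible in characteristic zero. -/
theorem det_degBlock_ciShift_ne_zero [CharZero k] (hdv : ∀ j, 1 ≤ dv j) {m : ℕ}
    (hm : 2 * m ≤ ∑ j, (dv j - 1)) :
    ∃ e : {a // ciDeg dv a = m} ≃ {b // ciDeg dv b = ∑ j, (dv j - 1) - m},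
      ((degBlock (ciShift k dv ^ (∑ j, (dv j - 1) - 2 * m)) (ciDeg dv) (ciDeg dv)
        (∑ j, (dv j - 1) - m) m).submatrix e id).det ≠ 0 := by
  have h := (isLefschetz_ciShift dv hdv).absDet_ne_zero m hm
  obtain ⟨e⟩ := nonempty_equiv_of_absDet_ne_zero h
  refine ⟨e, ?_⟩
  have key : ∀ (F : Type) [Field F], ((degBlock (ciShift F dv ^ (∑ j, (dv j - 1) - 2 * m))
      (ciDeg dv) (ciDeg dv) (∑ j, (dv j - 1) - m) m).submatrix e id).det =
      (((degBlock (ciShift ℤ dv ^ (∑ j, (dv j - 1) - 2 * m)) (ciDeg dv) (ciDeg dv)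
        (∑ j, (dv j - 1) - m) m).submatrix e id).det : F) := by
    intro F _
    rw [Int.cast_det]
    congr 1
    ext a' a
    simp only [degBlock, Matrix.submatrix_apply, Matrix.map_apply, ciShift_pow_apply]
    split_ifs <;> simp
  rw [absDet_eq _ e, key, abs_ne_zero, Int.cast_ne_zero] at h
  rwa [key, Int.cast_ne_zero]

theorem ciShift_pow_mulVec_injective [CharZero k] (hdv : ∀ j, 1 ≤ dv j) {i t : ℕ}
    (hi : 2 * i + t ≤ ∑ j, (dv j - 1)) {v : (∀ j, Fin (dv j)) → k}
    (hv : ∀ a, ciDeg dv a ≠ i → v a = 0) (h0 : (ciShift k dv ^ t).mulVec v = 0) : v = 0 := by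
  have hm : 2 * i ≤ ∑ j, (dv j - 1) := by omega
  obtain ⟨e, he⟩ := det_degBlock_ciShift_ne_zero (k := k) hdv hm
  have h1 : (ciShift k dv ^ (∑ j, (dv j - 1) - 2 * i)).mulVec v = 0 := by
    rw [show ∑ j, (dv j - 1) - 2 * i = (∑ j, (dv j - 1) - 2 * i - t) + t by omega, pow_add,
      ← Matrix.mulVec_mulVec, h0, Matrix.mulVec_zero]
  have h2 := Matrix.eq_zero_of_mulVec_eq_zero he (v := fun a => v a.1) (by
    ext a
    rcases h : e a with ⟨b, hb⟩
    have h3 := congrFun h1 b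
    rw [mulVec_eq_degBlock_mulVec (f := ciDeg dv) _ hv] at h3
    have h4 : ((degBlock (ciShift k dv ^ (∑ j, (dv j - 1) - 2 * i)) (ciDeg dv) (ciDeg dv)
      (∑ j, (dv j - 1) - i) i).mulVec fun a => v a.1) ⟨b, hb⟩ = 0 := h3
    rw [← h] at h4
    exact h4)
  ext a
  by_cases ha : ciDeg dv a = i
  · exact congrFun h2 ⟨a, ha⟩
  · exact hv a ha

theorem exists_ciShift_pow_mulVec_eq_of_two_mul_le [CharZero k] (hdv : ∀ j, 1 ≤ dv j) {m : ℕ}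
    (hm : 2 * m ≤ ∑ j, (dv j - 1)) {w : (∀ j, Fin (dv j)) → k}
    (hw : ∀ b, ciDeg dv b ≠ ∑ j, (dv j - 1) - m → w b = 0) :
    ∃ v, (∀ a, ciDeg dv a ≠ m → v a = 0) ∧
      (ciShift k dv ^ (∑ j, (dv j - 1) - 2 * m)).mulVec v = w := by
  obtain ⟨e, he⟩ := det_degBlock_ciShift_ne_zero (k := k) hdv hm
  obtain ⟨u, hu⟩ := (Matrix.mulVec_surjective_iff_isUnit.mpr
    ((Matrix.isUnit_iff_isUnit_det _).mpr he.isUnit)) fun a => w (e a).1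
  have hsupp : ∀ a, ciDeg dv a ≠ m → (if ha : ciDeg dv a = m then u ⟨a, ha⟩ else 0) = 0 :=
    fun a ha => dif_neg ha
  refine ⟨fun a => if ha : ciDeg dv a = m then u ⟨a, ha⟩ else 0, hsupp, ?_⟩
  ext b
  by_cases hb : ciDeg dv b = ∑ j, (dv j - 1) - m
  · rw [mulVec_eq_degBlock_mulVec (f := ciDeg dv) _ hsupp]
    have h1 := congrFun hu (e.symm ⟨b, hb⟩)
    simp only [Equiv.apply_symm_apply] at h1
    rw [← h1]
    have h2 : (fun y : {a // ciDeg dv a = m} =>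
        if ha : ciDeg dv y.1 = m then u ⟨y.1, ha⟩ else 0) = u := by
      ext y
      rw [dif_pos y.2]
    rw [h2]
    have h3 : ∀ c (hc : ciDeg dv b = c),
        (degBlock (ciShift k dv ^ (∑ j, (dv j - 1) - 2 * m)) (ciDeg dv) (ciDeg dv)
          (ciDeg dv b) m).mulVec u ⟨b, rfl⟩ =
        (degBlock (ciShift k dv ^ (∑ j, (dv j - 1) - 2 * m)) (ciDeg dv) (ciDeg dv)
          c m).mulVec u ⟨b, hc⟩ := by
      rintro c rfl
      rfl
    rw [h3 _ hb]
    simp [Matrix.mulVec, Matrix.submatrix_apply]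
  · rw [hw b hb]
    refine ciShift_pow_mulVec_of_ne hsupp b ?_
    omega

theorem exists_ciShift_pow_mulVec_eq [CharZero k] (hdv : ∀ j, 1 ≤ dv j) {i t : ℕ}
    (hi : ∑ j, (dv j - 1) ≤ 2 * i + t) {w : (∀ j, Fin (dv j)) → k}
    (hw : ∀ b, ciDeg dv b ≠ i + t → w b = 0) :
    ∃ v, (∀ a, ciDeg dv a ≠ i → v a = 0) ∧ (ciShift k dv ^ t).mulVec v = w := by
  by_cases ht : i + t ≤ ∑ j, (dv j - 1)
  · obtain ⟨v, hv, rfl⟩ := exists_ciShift_pow_mulVec_eq_of_two_mul_le (k := k) hdv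
      (m := ∑ j, (dv j - 1) - (i + t)) (w := w) (by omega) (fun b hb => hw b (by omega))
    refine ⟨(ciShift k dv ^ (i - (∑ j, (dv j - 1) - (i + t)))).mulVec v, fun a ha =>
      ciShift_pow_mulVec_of_ne hv a (by omega), ?_⟩
    rw [Matrix.mulVec_mulVec, ← pow_add]
    congr 2
    omega
  · refine ⟨0, fun _ _ => rfl, ?_⟩
    rw [Matrix.mulVec_zero]
    ext b
    have := (isLefschetz_ciShift dv hdv).deg_le b
    rw [hw b (by omega), Pi.zero_apply]

end FieldCoefficients

section Polynomials

open MvPolynomial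

variable {k : Type} [Field k] {n : ℕ} {dv : Fin n → ℕ}

/-- The exponent of a monomial as a finitely supported function. -/
noncomputable def ciExponent (dv : Fin n → ℕ) (a : ∀ j, Fin (dv j)) : Fin n →₀ ℕ :=
  Finsupp.equivFunOnFinite.symm fun j => (a j : ℕ)

theorem ciExponent_apply (a : ∀ j, Fin (dv j)) (j : Fin n) : ciExponent dv a j = a j := rfl

theorem ciExponent_injective : Function.Injective (ciExponent dv) := by
  intro a b h
  ext j
  exact DFunLike.congr_fun h j

theorem degree_ciExponent (a : ∀ j, Fin (dv j)) : (ciExponent dv a).degree = ciDeg dv a := by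
  simp [Finsupp.degree_eq_sum, ciExponent_apply, ciDeg]

/-- The coordinates of a polynomial in the monomial basis of the complete intersection. -/
noncomputable def ciCoord (k : Type) [Field k] (dv : Fin n → ℕ) :
    MvPolynomial (Fin n) k →ₗ[k] (∀ j, Fin (dv j)) → k :=
  LinearMap.pi fun a => lcoeff k (ciExponent dv a)

theorem ciCoord_apply (f : MvPolynomial (Fin n) k) (a : ∀ j, Fin (dv j)) :
    ciCoord k dv f a = coeff (ciExponent dv a) f := rfl

theorem ciCoord_eq_zero_iff (f : MvPolynomial (Fin n) k) :
    ciCoord k dv f = 0 ↔ f ∈ ciIdeal k n dv := by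
  have hI : ciIdeal k n dv = Ideal.span ((fun s => monomial s (1 : k)) ''
      Set.range fun j => Finsupp.single j (dv j)) := by
    unfold ciIdeal
    congr 1
    ext g
    simp [X_pow_eq_monomial, eq_comm]
  rw [hI, mem_ideal_span_monomial_image]
  constructor
  · intro h s hs
    by_contra! hlt
    have hs' : ∀ j, s j < dv j := fun j => by
      have := hlt _ ⟨j, rfl⟩
      simpa using this
    apply mem_support_iff.mp hs
    have h1 := congrFun h fun j => ⟨s j, hs' j⟩
    rw [ciCoord_apply] at h1
    have hexp : ciExponent dv (fun j => ⟨s j, hs' j⟩) = s := by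
      ext j
      rfl
    rw [hexp] at h1
    exact h1
  · intro h
    ext a
    by_contra ha
    obtain ⟨_, ⟨j, rfl⟩, hj⟩ := h _ (mem_support_iff.mpr ha)
    rw [Finsupp.single_le_iff, ciExponent_apply] at hj
    have := (a j).2
    omega

theorem ciCoord_sum_X_mul (f : MvPolynomial (Fin n) k) :
    ciCoord k dv ((∑ j, X j) * f) = (ciShift k dv).mulVec (ciCoord k dv f) := by
  ext b
  simp only [ciCoord_apply, Finset.sum_mul, coeff_sum, Matrix.mulVec, dotProduct, ciShift,
    Matrix.of_apply]
  rw [Finset.sum_comm]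
  refine Finset.sum_congr rfl fun j _ => ?_
  rw [coeff_X_mul']
  simp only [ite_mul, one_mul, zero_mul]
  split_ifs with hj
  · rw [Finsupp.mem_support_iff, ciExponent_apply] at hj
    let a : ∀ j, Fin (dv j) := Function.update b j ⟨b j - 1, by omega⟩
    rw [Finset.sum_eq_single a]
    · rw [if_pos ⟨by simp [a]; omega, fun m hm => by simp [a, hm]⟩]
      congr 1
      ext m
      rw [ciExponent_apply, Finsupp.tsub_apply, ciExponent_apply]
      by_cases hm : m = j
      · subst hm; simp [a]
      · simp [a, hm]
    · intro a' _ ha'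
      rw [if_neg]
      rintro ⟨h1, h2⟩
      apply ha'
      ext m
      by_cases hm : m = j
      · subst hm; simp [a]; omega
      · simp [a, hm, h2 m hm]
    · simp
  · rw [Finsupp.mem_support_iff, ciExponent_apply, not_not] at hj
    refine (Finset.sum_eq_zero fun a _ => if_neg ?_).symm
    omega

theorem ciCoord_sum_X_pow_mul (t : ℕ) (f : MvPolynomial (Fin n) k) :
    ciCoord k dv ((∑ j, X j) ^ t * f) = (ciShift k dv ^ t).mulVec (ciCoord k dv f) := by
  induction t with
  | zero => simp
  | succ t ih =>
    rw [pow_succ', mul_assoc, ciCoord_sum_X_mul, ih, Matrix.mulVec_mulVec, ← pow_succ']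

theorem ciCoord_of_isHomogeneous {f : MvPolynomial (Fin n) k} {i : ℕ} (hf : f.IsHomogeneous i)
    (a : ∀ j, Fin (dv j)) (ha : ciDeg dv a ≠ i) : ciCoord k dv f a = 0 :=
  hf.coeff_eq_zero (by rwa [degree_ciExponent])

theorem exists_ciCoord_eq {i : ℕ} {w : (∀ j, Fin (dv j)) → k}
    (hw : ∀ a, ciDeg dv a ≠ i → w a = 0) :
    ∃ f : MvPolynomial (Fin n) k, f.IsHomogeneous i ∧ ciCoord k dv f = w := by
  refine ⟨∑ a, monomial (ciExponent dv a) (w a), IsHomogeneous.sum _ _ _ fun a _ => ?_, ?_⟩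
  · by_cases ha : ciDeg dv a = i
    · exact isHomogeneous_monomial _ (by rw [degree_ciExponent, ha])
    · rw [hw a ha, monomial_zero]
      exact isHomogeneous_zero _ _ _
  · ext b
    simp [ciCoord_apply, coeff_sum, coeff_monomial, ciExponent_injective.eq_iff]

theorem hasSLPN_ciComp [CharZero k] (hdv : ∀ j, 1 ≤ dv j) : HasSLPN (ciComp k n dv) := by
  refine ⟨ciSumVars k n dv, ⟨∑ j, X j, IsHomogeneous.sum _ _ _ fun j _ => isHomogeneous_X _ _, rfl⟩,
    fun i t _ => ?_⟩
  have hmul : ∀ f, ciSumVars k n dv ^ t * Ideal.Quotient.mk (ciIdeal k n dv) f =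
      Ideal.Quotient.mk (ciIdeal k n dv) ((∑ j, X j) ^ t * f) := fun f => by
    rw [map_mul, map_pow]
    rfl
  rcases le_total (2 * i + t) (∑ j, (dv j - 1)) with hi | hi
  · left
    rintro _ ⟨f, hf, rfl⟩ h0
    change ciSumVars k n dv ^ t * Ideal.Quotient.mk (ciIdeal k n dv) f = 0 at h0
    change Ideal.Quotient.mk (ciIdeal k n dv) f = 0
    rw [hmul, Ideal.Quotient.eq_zero_iff_mem, ← ciCoord_eq_zero_iff, ciCoord_sum_X_pow_mul] at h0
    rw [Ideal.Quotient.eq_zero_iff_mem, ← ciCoord_eq_zero_iff]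
    exact ciShift_pow_mulVec_injective hdv hi (ciCoord_of_isHomogeneous hf) h0
  · right
    rintro _ ⟨g, hg, rfl⟩
    obtain ⟨u, hu, hug⟩ := exists_ciShift_pow_mulVec_eq hdv hi
      (ciCoord_of_isHomogeneous (dv := dv) hg)
    obtain ⟨f, hf, rfl⟩ := exists_ciCoord_eq hu
    refine ⟨Ideal.Quotient.mk (ciIdeal k n dv) f, ⟨f, hf, rfl⟩, ?_⟩
    rw [hmul]
    change _ = Ideal.Quotient.mk (ciIdeal k n dv) g
    rw [Ideal.Quotient.eq, ← ciCoord_eq_zero_iff, map_sub, ciCoord_sum_X_pow_mul, hug, sub_self]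

end Polynomials

/-- Let `k` have characteristic zero,
`A = k[x₁,…,xₙ]/(x₁^{d₁},…,xₙ^{dₙ})`, `ℓ = x₁ + ⋯ + xₙ`, `e = ∑ (d_j - 1)`, and for
`0 ≤ i ≤ e/2` let `a_{n,i,𝐝}` be the absolute value of the determinant of
`·ℓ^{e-2i} : A_i → A_{e-i}` in the monomial bases.  Then for `n ≥ 2`, with `t = e - 2i`,
`B = k[x₁,…,x_{n-1}]/(x₁^{d₁},…,x_{n-1}^{d_{n-1}})` and `h_j = dim_k B_j`:
`a_{n,i,𝐝} = (∏_{j=max{0,dₙ-t}}^{min{i,dₙ-1}} a_{n-1,i-j,𝐝'}) ·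
∏_{s=max{1,dₙ-i-1}}^{min{t-1,dₙ-1}} |det C_{t,s,dₙ}|^{h_{i+s-(dₙ-1)} - h_{i+s-dₙ}}`,
with `a_{1,i,(d₁)} = 1`.  In particular `a_{n,i,𝐝} ≠ 0` for all `0 ≤ i ≤ e/2` and `A` has
the strong Lefschetz property. -/
theorem statement_11 {k : Type} [Field k] [CharZero k]
    (n : ℕ) (hn : 1 ≤ n) (dv : Fin n → ℕ) (hdv : ∀ j, 1 ≤ dv j) :
    (∀ (hn2 : 2 ≤ n) (i : ℕ), 2 * i ≤ ∑ j : Fin n, (dv j - 1) →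
      ciDetAbs dv i =
        (∏ j ∈ Finset.Icc (dv ⟨n - 1, by omega⟩ - ((∑ j : Fin n, (dv j - 1)) - 2 * i))
            (min i (dv ⟨n - 1, by omega⟩ - 1)),
          ciDetAbs (fun m : Fin (n - 1) => dv (Fin.castLE (by omega) m)) (i - j)) *
        ∏ s ∈ Finset.Icc (max 1 (dv ⟨n - 1, by omega⟩ - i - 1))
            (min ((∑ j : Fin n, (dv j - 1)) - 2 * i - 1) (dv ⟨n - 1, by omega⟩ - 1)),
          |((Cmat ((∑ j : Fin n, (dv j - 1)) - 2 * i) s (dv ⟨n - 1, by omega⟩)).det : ℚ)| ^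
            ((ciHilb (fun m : Fin (n - 1) => dv (Fin.castLE (by omega) m))
                ((i : ℤ) + s - ((dv ⟨n - 1, by omega⟩ : ℤ) - 1)) : ℤ) -
             (ciHilb (fun m : Fin (n - 1) => dv (Fin.castLE (by omega) m))
                ((i : ℤ) + s - (dv ⟨n - 1, by omega⟩ : ℤ)) : ℤ)))
    ∧ (∀ (d1 : Fin 1 → ℕ) (i : ℕ), 2 * i ≤ ∑ j : Fin 1, (d1 j - 1) → ciDetAbs d1 i = 1)
    ∧ (∀ i : ℕ, 2 * i ≤ ∑ j : Fin n, (dv j - 1) → ciDetAbs dv i ≠ 0)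
    ∧ HasSLPN (ciComp k n dv) := by
  refine ⟨?_, fun d1 i hi => ciDetAbs_fin_one d1 hi, fun i hi => ciDetAbs_ne_zero dv hdv hi,
    hasSLPN_ciComp hdv⟩
  intro hn2 i hi
  obtain ⟨m, rfl⟩ : ∃ m, n = m + 1 := ⟨n - 1, by omega⟩
  exact ciDetAbs_succ dv hdv hi
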